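/- arXiv:math/0005252 — 4 statements merged into one kernel-verified Lean document; each statement's English description precedes it below -/
import Mathlib

section
/- For all λ ≥ 1, ε ≥ 0 and r > 0 there exists a constant c > 0, depending only on λ, ε and r, with the following property: if φ : ℍ ×₂ ℝ → ℍ ×₂ ℝ is a (λ,ε)-quasi-isometric embedding, w ∈ ℍ, h₀ ≥ 0, and p, q ∈ ℍ ×₂ ℝ are points whose horizontal (ℍ-) coordinates both lie within hyperbolic distance r of w, and the vertical (ℝ-) coordinates of φ(p) and φ(q) differ in absolute value by at most h₀, then dist(p, q) ≤ c·h₀ + c. -/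
open UpperHalfPlane

/-- `ℍ ×₂ ℝ`: the product of the hyperbolic plane and the real line with the ℓ² metric. -/
abbrev H2R := WithLp 2 (UpperHalfPlane × ℝ)

/-- The horizontal (ℍ-) coordinate of a point of `ℍ ×₂ ℝ`. -/
noncomputable def horiz (p : H2R) : UpperHalfPlane := (WithLp.equiv 2 (UpperHalfPlane × ℝ) p).1

/-- The vertical (ℝ-) coordinate of a point of `ℍ ×₂ ℝ`. -/
noncomputable def vert (p : H2R) : ℝ := (WithLp.equiv 2 (UpperHalfPlane × ℝ) p).2

/-- A `(λ,ε)`-quasi-isometric embedding between metric spaces. -/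
def IsQIE {X Y : Type*} [PseudoMetricSpace X] [PseudoMetricSpace Y]
    (lam eps : ℝ) (f : X → Y) : Prop :=
  ∀ x y, (1 / lam) * dist x y - eps ≤ dist (f x) (f y) ∧
    dist (f x) (f y) ≤ lam * dist x y + eps


lemma vcb_ptolemy (a b c m : UpperHalfPlane) :
    Real.sinh (dist a b / 2) * Real.sinh (dist c m / 2) ≤
      Real.sinh (dist a c / 2) * Real.sinh (dist b m / 2) +
      Real.sinh (dist c b / 2) * Real.sinh (dist a m / 2) := by
  simp only [UpperHalfPlane.sinh_half_dist]
  have ha := Real.sqrt_pos.2 a.im_pos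
  have hb := Real.sqrt_pos.2 b.im_pos
  have hc := Real.sqrt_pos.2 c.im_pos
  have hm := Real.sqrt_pos.2 m.im_pos
  simp only [Real.sqrt_mul (UpperHalfPlane.im_pos _).le]
  have h := EuclideanGeometry.mul_dist_le_mul_dist_add_mul_dist (a : ℂ) c b m
  have e1 : ∀ x y : ℝ, x / (2 * (√a.im * √b.im)) * (y / (2 * (√c.im * √m.im)))
      = (x * y) / (4 * (√a.im * √b.im * √c.im * √m.im)) := by
    intro x y; field_simp; ring
  have e2 : ∀ x y : ℝ, x / (2 * (√a.im * √c.im)) * (y / (2 * (√b.im * √m.im)))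
      = (x * y) / (4 * (√a.im * √b.im * √c.im * √m.im)) := by
    intro x y; field_simp; ring
  have e3 : ∀ x y : ℝ, x / (2 * (√c.im * √b.im)) * (y / (2 * (√a.im * √m.im)))
      = (x * y) / (4 * (√a.im * √b.im * √c.im * √m.im)) := by
    intro x y; field_simp; ring
  rw [e1, e2, e3, ← add_div]
  gcongr

/-- The inverted (Ptolemaic) metric based at `m`. -/
noncomputable def vcbRho (m x y : UpperHalfPlane) : ℝ :=
  Real.sinh (dist x y / 2) / (Real.sinh (dist x m / 2) * Real.sinh (dist y m / 2))

lemma vcbRho_triangle (m a b c : UpperHalfPlane) (ha : 0 < dist a m) (hb : 0 < dist b m)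
    (hc : 0 < dist c m) : vcbRho m a b ≤ vcbRho m a c + vcbRho m c b := by
  have h := vcb_ptolemy a b c m
  have ha' : 0 < Real.sinh (dist a m / 2) := Real.sinh_pos_iff.2 (by positivity)
  have hb' : 0 < Real.sinh (dist b m / 2) := Real.sinh_pos_iff.2 (by positivity)
  have hc' : 0 < Real.sinh (dist c m / 2) := Real.sinh_pos_iff.2 (by positivity)
  unfold vcbRho
  rw [div_add_div _ _ (by positivity) (by positivity), div_le_div_iff₀ (by positivity) (by positivity)]
  have := mul_le_mul_of_nonneg_left h (by positivity : 0 ≤ Real.sinh (dist a m / 2) *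
    Real.sinh (dist b m / 2) * Real.sinh (dist c m / 2))
  nlinarith [this]

lemma vcbRho_le (m x y : UpperHalfPlane) (M R : ℝ) (hR : 0 < R) (hxy : dist x y ≤ M)
    (hx : R ≤ dist x m) (hy : R ≤ dist y m) :
    vcbRho m x y ≤ Real.sinh (M / 2) / Real.sinh (R / 2) ^ 2 := by
  have hR' : 0 < Real.sinh (R / 2) := Real.sinh_pos_iff.2 (by positivity)
  have h1 : Real.sinh (R / 2) ≤ Real.sinh (dist x m / 2) := Real.sinh_le_sinh.2 (by linarith)
  have h2 : Real.sinh (R / 2) ≤ Real.sinh (dist y m / 2) := Real.sinh_le_sinh.2 (by linarith)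
  have h3 : Real.sinh (dist x y / 2) ≤ Real.sinh (M / 2) := Real.sinh_le_sinh.2 (by linarith)
  have h4 : 0 ≤ Real.sinh (dist x y / 2) := Real.sinh_nonneg_iff.2 (by positivity)
  unfold vcbRho
  rw [sq]
  gcongr
  linarith

lemma vcbRho_chain (m : UpperHalfPlane) (M R : ℝ) (hR : 0 < R) (f : ℕ → UpperHalfPlane) (n : ℕ)
    (hf : ∀ i < n, dist (f i) (f (i + 1)) ≤ M) (hm : ∀ i ≤ n, R ≤ dist (f i) m) :
    vcbRho m (f 0) (f n) ≤ n * (Real.sinh (M / 2) / Real.sinh (R / 2) ^ 2) := by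
  induction n with
  | zero => simp [vcbRho]
  | succ k ih =>
    have h1 := ih (fun i hi => hf i (by omega)) (fun i hi => hm i (by omega))
    have h2 := vcbRho_le m (f k) (f (k + 1)) M R hR (hf k (by omega)) (hm k (by omega))
      (hm (k + 1) le_rfl)
    have h3 := vcbRho_triangle m (f 0) (f (k + 1)) (f k) (hR.trans_le (hm 0 (by omega)))
      (hR.trans_le (hm _ le_rfl)) (hR.trans_le (hm k (by omega)))
    push_cast
    linarith

lemma vcb_mid_aux (a b : UpperHalfPlane) (hab : a.im ≤ b.im) :
    ∃ m : UpperHalfPlane, dist a b / 2 ≤ dist a m ∧ dist a b / 2 ≤ dist b m ∧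
      Real.sinh (dist a m / 2) * Real.sinh (dist b m / 2) ≤ Real.sinh (dist a b / 2) := by
  set D := dist a b with hD
  have hD0 : 0 ≤ D := dist_nonneg
  have ha := a.im_pos
  have hb := b.im_pos
  let m : UpperHalfPlane := ⟨⟨a.re, a.im * Real.exp (D / 2)⟩, by positivity⟩
  have hre : m.re = a.re := rfl
  have him : m.im = a.im * Real.exp (D / 2) := rfl
  have ham : dist a m = D / 2 := by
    rw [UpperHalfPlane.dist_of_re_eq (hre.symm), him, Real.log_mul ha.ne' (Real.exp_pos _).ne',
      Real.log_exp, Real.dist_eq]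
    rw [show Real.log a.im - (Real.log a.im + D / 2) = -(D / 2) by ring, abs_neg,
      abs_of_nonneg (by positivity)]
  refine ⟨m, ham.ge, ?_, ?_⟩
  · have := dist_triangle a m b
    rw [dist_comm b m]; linarith
  have key : Real.sinh (dist b m / 2) ≤ 2 * Real.cosh (D / 4) := by
    refine abs_le_of_sq_le_sq' ?_ (by positivity) |>.2
    have c1 : Real.cosh (dist b m) = 2 * Real.sinh (dist b m / 2) ^ 2 + 1 := by
      have := Real.cosh_two_mul (dist b m / 2)
      have h2 := Real.cosh_sq (dist b m / 2)
      rw [mul_div_cancel₀ _ two_ne_zero] at this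
      linarith
    have c2 : Real.cosh (D / 2) = 2 * Real.cosh (D / 4) ^ 2 - 1 := by
      have := Real.cosh_two_mul (D / 4)
      have h2 := Real.cosh_sq (D / 4)
      rw [show 2 * (D / 4) = D / 2 by ring] at this
      linarith
    have c3 := UpperHalfPlane.cosh_dist' a b
    have c4 := UpperHalfPlane.cosh_dist' b m
    rw [← hD] at c3
    rw [hre, him] at c4
    have hE1 : 1 ≤ Real.exp (D / 2) := Real.one_le_exp (by positivity)
    have c5 : Real.cosh D ≤ (Real.exp (D / 2) ^ 2 + 1) / 2 := by
      rw [Real.cosh_eq, ← Real.exp_nat_mul]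
      have : Real.exp (-D) ≤ 1 := Real.exp_le_one_iff.2 (by linarith)
      have : ((2 : ℕ) : ℝ) * (D / 2) = D := by push_cast; ring
      rw [this]; linarith
    have c6 : Real.exp (D / 2) ≤ 2 * Real.cosh (D / 2) := by
      rw [Real.cosh_eq]; have := Real.exp_pos (-(D / 2)); linarith
    set E := Real.exp (D / 2)
    have c7 : Real.cosh (dist b m) ≤ 2 * E := by
      rw [c4, div_le_iff₀ (by positivity)]
      rw [c3, div_le_iff₀ (by positivity)] at c5
      have : a.im * a.im ≤ a.im * b.im := by gcongr
      have h3 : a.im * a.im * E ^ 2 ≤ a.im * b.im * E ^ 2 := by gcongr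
      have h4 : a.im * b.im * 1 ≤ a.im * b.im * E ^ 2 := by gcongr; nlinarith
      nlinarith [sq_nonneg a.im]
    nlinarith
  have hs : Real.sinh (D / 2) = 2 * Real.sinh (D / 4) * Real.cosh (D / 4) := by
    rw [← Real.sinh_two_mul]; congr 1; ring
  rw [ham, hs, show D / 2 / 2 = D / 4 by ring]
  have : 0 ≤ Real.sinh (D / 4) := Real.sinh_nonneg_iff.2 (by positivity)
  nlinarith

lemma vcb_mid (a b : UpperHalfPlane) :
    ∃ m : UpperHalfPlane, dist a b / 2 ≤ dist a m ∧ dist a b / 2 ≤ dist b m ∧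
      Real.sinh (dist a m / 2) * Real.sinh (dist b m / 2) ≤ Real.sinh (dist a b / 2) := by
  rcases le_total a.im b.im with h | h
  · exact vcb_mid_aux a b h
  · obtain ⟨m, h1, h2, h3⟩ := vcb_mid_aux b a h
    rw [dist_comm b a] at h1 h2 h3
    exact ⟨m, h2, h1, by rw [mul_comm]; exact h3⟩

/-- Rays going down from height `w.im`. -/
noncomputable def vcbRay (w : UpperHalfPlane) (j : ℕ) (t : ℝ) : UpperHalfPlane :=
  ⟨⟨w.re + j * w.im, w.im * Real.exp (-t)⟩, mul_pos w.im_pos (Real.exp_pos _)⟩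

lemma vcbRay_same (w : UpperHalfPlane) (j : ℕ) (t u : ℝ) :
    dist (vcbRay w j t) (vcbRay w j u) = |t - u| := by
  have h : ∀ t, (vcbRay w j t).im = w.im * Real.exp (-t) := fun _ => rfl
  rw [UpperHalfPlane.dist_of_re_eq (show (vcbRay w j t).re = (vcbRay w j u).re from rfl), h, h, Real.log_mul w.im_pos.ne' (Real.exp_pos _).ne',
    Real.log_mul w.im_pos.ne' (Real.exp_pos _).ne', Real.log_exp, Real.log_exp, Real.dist_eq,
    abs_sub_comm]
  congr 1; ring

lemma vcbRay_zero (w : UpperHalfPlane) (j : ℕ) : dist w (vcbRay w j 0) ≤ j := by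
  refine (UpperHalfPlane.dist_le_dist_coe_div_sqrt _ _).trans ?_
  have h : (vcbRay w j 0).im = w.im := by
    change w.im * Real.exp (-0) = w.im
    simp
  have hr : (vcbRay w j 0).re = w.re + j * w.im := rfl
  rw [h, Real.sqrt_mul_self w.im_pos.le, div_le_iff₀ w.im_pos, Complex.dist_of_im_eq]
  · rw [UpperHalfPlane.coe_re, UpperHalfPlane.coe_re, hr, Real.dist_eq]
    rw [show w.re - (w.re + j * w.im) = -(j * w.im) by ring, abs_neg, abs_of_nonneg]
    have := w.im_pos; positivity
  · rw [UpperHalfPlane.coe_im, UpperHalfPlane.coe_im, h]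

lemma vcbRay_ne (w : UpperHalfPlane) (j k : ℕ) (hjk : j ≠ k) (t u : ℝ) (ht : 0 ≤ t) :
    t + u ≤ dist (vcbRay w j t) (vcbRay w k u) := by
  have hw := w.im_pos
  have h := UpperHalfPlane.cosh_dist' (vcbRay w j t) (vcbRay w k u)
  have e1 : (vcbRay w j t).re = w.re + j * w.im := rfl
  have e2 : (vcbRay w k u).re = w.re + k * w.im := rfl
  have e3 : (vcbRay w j t).im = w.im * Real.exp (-t) := rfl
  have e4 : (vcbRay w k u).im = w.im * Real.exp (-u) := rfl
  rw [e1, e2, e3, e4] at h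
  have hjk' : (1 : ℝ) ≤ ((j : ℝ) - k) ^ 2 := by
    have : (1 : ℤ) ≤ ((j : ℤ) - k) ^ 2 := by
      have : ((j : ℤ) - k) ≠ 0 := by omega
      have := sq_pos_of_ne_zero this
      omega
    exact_mod_cast this
  have hc : Real.cosh (t + u) ≤ Real.cosh (dist (vcbRay w j t) (vcbRay w k u)) := by
    rw [h, le_div_iff₀ (by positivity), Real.cosh_eq, Real.exp_add, neg_add, Real.exp_add]
    have h1 : Real.exp t * Real.exp (-t) = 1 := by rw [← Real.exp_add]; simp
    have h2 : Real.exp u * Real.exp (-u) = 1 := by rw [← Real.exp_add]; simp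
    have h5 : Real.exp (-t) ^ 2 * Real.exp (-u) ^ 2 ≤ Real.exp (-t) ^ 2 + Real.exp (-u) ^ 2 := by
      have h7 : Real.exp (-t) ≤ 1 := Real.exp_le_one_iff.2 (by linarith)
      have h8 : Real.exp (-t) ^ 2 ≤ 1 := pow_le_one₀ (Real.exp_pos _).le h7
      nlinarith [sq_nonneg (Real.exp (-u)), sq_nonneg (Real.exp (-t))]
    have h6 : (Real.exp t * Real.exp u + Real.exp (-t) * Real.exp (-u)) / 2 *
      (2 * (w.im * Real.exp (-t)) * (w.im * Real.exp (-u))) = w.im ^ 2 * ((Real.exp t * Real.exp (-t)) * (Real.exp u * Real.exp (-u))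
        + Real.exp (-t) ^ 2 * Real.exp (-u) ^ 2) := by ring
    rw [h6, h1, h2]
    nlinarith [mul_le_mul_of_nonneg_left hjk' (sq_nonneg w.im), mul_le_mul_of_nonneg_left h5 (sq_nonneg w.im)]
  rw [Real.cosh_le_cosh, abs_of_nonneg dist_nonneg] at hc
  exact (le_abs_self _).trans hc

lemma vcb_pack (N : ℕ) (x : ℕ → ℝ) (c B σ : ℝ) (hσ : 0 < σ) (hB : 0 ≤ B)
    (hx : ∀ j < N, |x j - c| ≤ B) (hs : ∀ j < N, ∀ k < N, j ≠ k → σ ≤ |x j - x k|) :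
    (N : ℝ) ≤ 2 * B / σ + 1 := by
  have hinj : N ≤ ⌊2 * B / σ⌋₊ + 1 := by
    by_contra hcon
    push Not at hcon
    obtain ⟨j, hj, k, hk, hne, heq⟩ := Finset.exists_ne_map_eq_of_card_lt_of_maps_to
      (s := Finset.range N) (t := Finset.range (⌊2 * B / σ⌋₊ + 1))
      (f := fun j => ⌊(x j - c + B) / σ⌋₊) (by simpa using hcon) (by
        intro j hj
        simp only [Finset.coe_range, Set.mem_Iio] at hj ⊢
        have := abs_le.1 (hx j hj)
        refine Nat.lt_succ_of_le (Nat.floor_le_floor ?_)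
        gcongr
        linarith)
    simp only [Finset.mem_range] at hj hk
    have h1 := abs_le.1 (hx j hj)
    have h2 := abs_le.1 (hx k hk)
    have p1 : 0 ≤ (x j - c + B) / σ := div_nonneg (by linarith) hσ.le
    have p2 : 0 ≤ (x k - c + B) / σ := div_nonneg (by linarith) hσ.le
    have a1 := Nat.floor_le p1
    have a2 := Nat.floor_le p2
    have b1 := Nat.lt_floor_add_one ((x j - c + B) / σ)
    have b2 := Nat.lt_floor_add_one ((x k - c + B) / σ)
    rw [heq] at a1 b1
    have h3 : |(x j - c + B) / σ - (x k - c + B) / σ| < 1 := by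
      rw [abs_lt]; constructor <;> linarith
    rw [← sub_div, abs_div, abs_of_pos hσ, div_lt_one hσ] at h3
    have := hs j hj k hk hne
    rw [show x j - c + B - (x k - c + B) = x j - x k by ring] at h3
    linarith
  calc (N : ℝ) ≤ (⌊2 * B / σ⌋₊ : ℝ) + 1 := by exact_mod_cast hinj
    _ ≤ _ := by gcongr; exact Nat.floor_le (by positivity)

lemma vcb_dist_sq (x y : H2R) :
    dist x y = √(dist (horiz x) (horiz y) ^ 2 + |vert x - vert y| ^ 2) := by
  rw [WithLp.prod_dist_eq_add (by norm_num), Real.sqrt_eq_rpow]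
  simp only [ENNReal.toReal_ofNat, Real.rpow_ofNat]
  rfl

lemma vcb_horiz_le (x y : H2R) : dist (horiz x) (horiz y) ≤ dist x y := by
  rw [vcb_dist_sq]
  apply Real.le_sqrt_of_sq_le
  nlinarith [sq_nonneg |vert x - vert y|]

lemma vcb_vert_le (x y : H2R) : |vert x - vert y| ≤ dist x y := by
  rw [vcb_dist_sq]
  apply Real.le_sqrt_of_sq_le
  nlinarith [sq_nonneg (dist (horiz x) (horiz y))]

lemma vcb_dist_le (x y : H2R) : dist x y ≤ dist (horiz x) (horiz y) + |vert x - vert y| := by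
  rw [vcb_dist_sq]
  apply Real.sqrt_le_iff.2
  have : 0 ≤ dist (horiz x) (horiz y) := dist_nonneg
  exact ⟨by positivity, by nlinarith [abs_nonneg (vert x - vert y)]⟩

/-- The point with given coordinates. -/
noncomputable def vcbPt (z : UpperHalfPlane) (s : ℝ) : H2R := WithLp.toLp 2 (z, s)

@[simp] lemma horiz_vcbPt (z : UpperHalfPlane) (s : ℝ) : horiz (vcbPt z s) = z := rfl
@[simp] lemma vert_vcbPt (z : UpperHalfPlane) (s : ℝ) : vert (vcbPt z s) = s := rfl

lemma vcbRho_comm (m x y : UpperHalfPlane) : vcbRho m x y = vcbRho m y x := by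
  unfold vcbRho
  rw [dist_comm x y, mul_comm]

lemma vcb_cross (m w : UpperHalfPlane) (M R K : ℝ) (hR : 0 < R) (F : H2R → UpperHalfPlane)
    (hK : 1 ≤ K) (hF : ∀ x y, dist x y ≤ K → dist (F x) (F y) ≤ M)
    (j : ℕ) (p q : H2R) (L : ℕ) (v : ℕ → ℝ) (v0 : v 0 = vert p) (vL : v L = vert q)
    (hv : ∀ i < L, |v i - v (i + 1)| ≤ 1)
    (hp : dist (horiz p) (vcbRay w j 0) ≤ K) (hq : dist (horiz q) (vcbRay w j 0) ≤ K)
    (hpm : R ≤ dist (F p) m) (hqm : R ≤ dist (F q) m)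
    (hrho : (3 * L + 2) * (Real.sinh (M / 2) / Real.sinh (R / 2) ^ 2) < vcbRho m (F p) (F q)) :
    ∃ k ≤ L, ∃ i ≤ L, (k = L ∨ i = 0 ∨ i = L) ∧
      dist (F (vcbPt (vcbRay w j k) (v i))) m < R := by
  by_contra hcon
  push Not at hcon
  have hor : ∀ (s : ℝ) (k : ℕ),
      dist (F (vcbPt (vcbRay w j k) s)) (F (vcbPt (vcbRay w j (k + 1 : ℕ)) s)) ≤ M := by
    intro s k
    refine hF _ _ ((vcb_dist_le _ _).trans ?_)
    simp only [horiz_vcbPt, vert_vcbPt, vcbRay_same]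
    push_cast
    norm_num
    exact hK
  have c1 := vcbRho_chain m M R hR (fun k => F (vcbPt (vcbRay w j k) (v 0))) L
    (fun i _ => hor _ i) (fun i hi => hcon i hi 0 (by omega) (by simp))
  have c2 := vcbRho_chain m M R hR (fun i => F (vcbPt (vcbRay w j L) (v i))) L
    (fun i hi => by
      refine hF _ _ ((vcb_dist_le _ _).trans ?_)
      simp only [horiz_vcbPt, vert_vcbPt, dist_self, zero_add]
      exact (hv i hi).trans hK) (fun i hi => hcon L le_rfl i hi (by simp))
  have c3 := vcbRho_chain m M R hR (fun k => F (vcbPt (vcbRay w j k) (v L))) L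
    (fun i _ => hor _ i) (fun i hi => hcon i hi L le_rfl (by simp))
  simp only [Nat.cast_zero] at c1 c2 c3
  have m1 := hcon 0 (by omega) 0 (by omega) (by simp)
  have m2 := hcon L le_rfl 0 (by omega) (by simp)
  have m3 := hcon L le_rfl L le_rfl (by simp)
  have m4 := hcon 0 (by omega) L le_rfl (by simp)
  simp only [Nat.cast_zero] at m1 m4
  have d1 := vcbRho_le m (F p) (F (vcbPt (vcbRay w j 0) (v 0))) M R hR
    (hF _ _ ((vcb_dist_le _ _).trans (by simpa [v0] using hp))) hpm m1
  have d2 := vcbRho_le m (F q) (F (vcbPt (vcbRay w j 0) (v L))) M R hR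
    (hF _ _ ((vcb_dist_le _ _).trans (by simpa [vL] using hq))) hqm m4
  rw [vcbRho_comm] at c3 d2
  have P : ∀ {x : ℝ}, R ≤ x → 0 < x := fun h => hR.trans_le h
  have t1 := vcbRho_triangle m _ _ _ (P hpm) (P hqm) (P m1)
  have t2 := vcbRho_triangle m _ _ _ (P m1) (P hqm) (P m2)
  have t3 := vcbRho_triangle m _ _ _ (P m2) (P hqm) (P m3)
  have t4 := vcbRho_triangle m _ _ _ (P m3) (P hqm) (P m4)
  linarith

set_option maxHeartbeats 1600000 in
/-- If the horizontal coordinates of `p` and `q` lie in a common vertical cylinder of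
radius `r` and the vertical coordinates of `φ p` and `φ q` differ by at most `h₀`,
then `dist p q ≤ c·h₀ + c`, for a constant `c` depending only on `λ`, `ε`, `r`. -/
theorem vertical_cylinder_bound (lam eps r : ℝ) (hlam : 1 ≤ lam) (heps : 0 ≤ eps)
    (hr : 0 < r) :
    ∃ c > (0 : ℝ), ∀ φ : H2R → H2R, IsQIE lam eps φ →
      ∀ (w : UpperHalfPlane) (h₀ : ℝ), 0 ≤ h₀ →
        ∀ p q : H2R, dist (horiz p) w ≤ r → dist (horiz q) w ≤ r →
          |vert (φ p) - vert (φ q)| ≤ h₀ →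
          dist p q ≤ c * h₀ + c := by
  have hl0 : 0 < lam := by linarith
  obtain ⟨N, hN⟩ : ∃ N : ℕ, 48 * lam ^ 4 + 1 < N := exists_nat_gt _
  obtain ⟨K, hKdef⟩ : ∃ K : ℝ, K = r + N + 1 := ⟨_, rfl⟩
  have hN0 : (0 : ℝ) ≤ N := Nat.cast_nonneg _
  have hK1 : 1 ≤ K := by linarith
  obtain ⟨M, hMdef⟩ : ∃ M : ℝ, M = lam * K + eps := ⟨_, rfl⟩
  have hM0 : 0 < M := by rw [hMdef]; positivity
  obtain ⟨S, hSdef⟩ : ∃ S : ℝ, S = Real.sinh (M / 2) := ⟨_, rfl⟩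
  have hS0 : 0 < S := by rw [hSdef]; exact Real.sinh_pos_iff.2 (by positivity)
  obtain ⟨c, hc⟩ : ∃ c : ℝ, c = 1 + 2 * lam + 2 * lam * eps + 32768 * lam ^ 6 * S + 12 * lam * M +
    16 * lam ^ 3 * eps := ⟨_, rfl⟩
  have hn1 : 0 ≤ 2 * lam * eps := by positivity
  have hn2 : 0 ≤ 32768 * lam ^ 6 * S := by positivity
  have hn3 : 0 ≤ 12 * lam * M := by positivity
  have hn4 : 0 ≤ 16 * lam ^ 3 * eps := by positivity
  refine ⟨c, by linarith, ?_⟩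
  intro φ hφ w h₀ hh p q hpw hqw hver
  by_contra hcon
  push Not at hcon
  obtain ⟨D, hD⟩ : ∃ D : ℝ, D = dist p q := ⟨_, rfl⟩
  rw [← hD] at hcon
  have hch : 2 * lam * h₀ ≤ c * h₀ := by gcongr; linarith
  have hch0 : 0 ≤ 2 * lam * h₀ := by positivity
  have hDpos : 1 ≤ D := by linarith
  obtain ⟨A, hA⟩ : ∃ A : ℝ, A = dist (horiz (φ p)) (horiz (φ q)) := ⟨_, rfl⟩
  have hφpq := hφ p q
  rw [← hD] at hφpq
  have hAup : A ≤ lam * D + eps := by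
    rw [hA]; exact (vcb_horiz_le _ _).trans hφpq.2
  have hlamD : 1 / lam * D = D / lam := by ring
  have hDA : D ≤ 2 * lam * A := by
    have h1 : D / lam - eps ≤ A + h₀ := by
      rw [← hlamD, hA]; linarith [vcb_dist_le (φ p) (φ q), hφpq.1]
    have h2 : D / lam ≤ A + h₀ + eps := by linarith
    rw [div_le_iff₀ hl0] at h2
    have h3 : (A + h₀ + eps) * lam = lam * A + lam * h₀ + lam * eps := by ring
    linarith
  have hA0 : 0 < A := by
    by_contra h
    push Not at h
    have : 2 * lam * A ≤ 0 := mul_nonpos_of_nonneg_of_nonpos (by positivity) h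
    linarith
  obtain ⟨m, ham, hbm, hmid⟩ := vcb_mid (horiz (φ p)) (horiz (φ q))
  rw [← hA] at ham hbm hmid
  obtain ⟨R, hRdef⟩ : ∃ R : ℝ, R = A / (16 * lam ^ 2) := ⟨_, rfl⟩
  have hR0 : 0 < R := by rw [hRdef]; positivity
  have hl2 : 1 ≤ lam ^ 2 := one_le_pow₀ hlam
  have hRA : R ≤ A / 16 := by
    rw [hRdef]; gcongr; linarith
  have hRD : D / (32 * lam ^ 3) ≤ R := by
    rw [hRdef, div_le_div_iff₀ (by positivity) (by positivity)]
    calc D * (16 * lam ^ 2) ≤ (2 * lam * A) * (16 * lam ^ 2) := by gcongr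
      _ = _ := by ring
  obtain ⟨L, hLdef⟩ : ∃ L : ℕ, L = ⌈D⌉₊ := ⟨_, rfl⟩
  have hLD : D ≤ L := by rw [hLdef]; exact Nat.le_ceil _
  have hLD' : (L : ℝ) ≤ D + 1 := by rw [hLdef]; exact (Nat.ceil_lt_add_one (by linarith)).le
  have hL0 : (0 : ℝ) < L := by linarith
  have hrho : (3 * L + 2) * (Real.sinh (M / 2) / Real.sinh (R / 2) ^ 2) <
      vcbRho m (horiz (φ p)) (horiz (φ q)) := by
    have h1 : 1 ≤ vcbRho m (horiz (φ p)) (horiz (φ q)) := by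
      unfold vcbRho
      rw [← hA, one_le_div]
      · exact hmid
      · exact mul_pos (Real.sinh_pos_iff.2 (by linarith)) (Real.sinh_pos_iff.2 (by linarith))
    refine lt_of_lt_of_le ?_ h1
    rw [← hSdef]
    have h2 : D / (64 * lam ^ 3) ≤ Real.sinh (R / 2) := by
      refine le_trans ?_ (Real.self_le_sinh_iff.2 (by positivity))
      have : D / (64 * lam ^ 3) = D / (32 * lam ^ 3) / 2 := by field_simp; norm_num
      linarith
    have h3 : 0 < D / (64 * lam ^ 3) := by positivity
    have h4 : (D / (64 * lam ^ 3)) ^ 2 ≤ Real.sinh (R / 2) ^ 2 := by gcongr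
    have h5 : (3 * L + 2) * S < (D / (64 * lam ^ 3)) ^ 2 := by
      have : (D / (64 * lam ^ 3)) ^ 2 = D ^ 2 / (4096 * lam ^ 6) := by
        rw [div_pow, mul_pow, ← pow_mul]; norm_num
      rw [this, lt_div_iff₀ (by positivity)]
      have h6 : (3 * L + 2) * S ≤ 8 * D * S := by gcongr; linarith
      calc (3 * L + 2) * S * (4096 * lam ^ 6) ≤ 8 * D * S * (4096 * lam ^ 6) := by gcongr
        _ = D * (32768 * lam ^ 6 * S) := by ring
        _ < D * D := by gcongr; linarith
        _ = D ^ 2 := by ring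
    rw [← mul_div_assoc, div_lt_one (by positivity)]
    linarith
  -- the vertical partition
  let v : ℕ → ℝ := fun i => vert p + (vert q - vert p) * (i / L)
  have v0 : v 0 = vert p := by simp [v]
  have vL : v L = vert q := by simp [v, hL0.ne']
  have hT : |vert q - vert p| ≤ D := by
    rw [abs_sub_comm, hD]; exact vcb_vert_le _ _
  have hv : ∀ i < L, |v i - v (i + 1)| ≤ 1 := by
    intro i _
    have : v i - v (i + 1) = -((vert q - vert p) / L) := by
      simp only [v]; push_cast; field_simp; ring
    rw [this, abs_neg, abs_div, abs_of_pos hL0, div_le_one hL0]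
    linarith
  have hvp : ∀ i ≤ L, |vert p - v i| ≤ D := by
    intro i hi
    have : vert p - v i = -((vert q - vert p) * (i / L)) := by simp only [v]; ring
    have hi' : (i : ℝ) / L ≤ 1 := by
      rw [div_le_one hL0]; exact_mod_cast hi
    have hi0 : (0 : ℝ) ≤ (i : ℝ) / L := by positivity
    rw [this, abs_neg, abs_mul, abs_of_nonneg hi0]
    exact (mul_le_of_le_one_right (abs_nonneg _) hi').trans hT
  have hF : ∀ x y, dist x y ≤ K → dist (horiz (φ x)) (horiz (φ y)) ≤ M := by
    intro x y hxy
    refine (vcb_horiz_le _ _).trans ((hφ x y).2.trans ?_)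
    rw [hMdef]; gcongr
  have hray : ∀ x : H2R, dist (horiz x) w ≤ r → ∀ j < N, ∀ k : ℕ,
      dist (horiz x) (vcbRay w j k) ≤ r + N + k := by
    intro x hx j hj k
    have h1 := dist_triangle (horiz x) w (vcbRay w j k)
    have h2 := dist_triangle w (vcbRay w j 0) (vcbRay w j k)
    have h3 := vcbRay_zero w j
    rw [vcbRay_same, zero_sub, abs_neg, abs_of_nonneg (Nat.cast_nonneg k)] at h2
    have h4 : (j : ℝ) ≤ N := by exact_mod_cast hj.le
    linarith
  have hcross : ∀ j : ℕ, ∃ y : ℕ × ℕ, j < N → y.1 ≤ L ∧ y.2 ≤ L ∧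
      (y.1 = L ∨ y.2 = 0 ∨ y.2 = L) ∧
      dist (horiz (φ (vcbPt (vcbRay w j y.1) (v y.2)))) m < R := by
    intro j
    by_cases hj : j < N
    · have hp := hray p hpw j hj 0
      have hq := hray q hqw j hj 0
      simp only [Nat.cast_zero] at hp hq
      obtain ⟨k, hk, i, hi, h1, h2⟩ := vcb_cross m w M R K hR0 (fun x => horiz (φ x)) hK1 hF j p q L
        v v0 vL hv (by linarith) (by linarith) (by linarith) (by linarith) hrho
      exact ⟨(k, i), fun _ => ⟨hk, hi, h1, h2⟩⟩
    · exact ⟨(0, 0), fun h => absurd h hj⟩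
  choose y hy using hcross
  let Y : ℕ → H2R := fun j => vcbPt (vcbRay w j (y j).1) (v (y j).2)
  have hYm : ∀ j < N, dist (horiz (φ (Y j))) m < R := fun j hj => (hy j hj).2.2.2
  have hAM : 6 * M ≤ A := by
    have : 12 * lam * M ≤ 2 * lam * A := by linarith
    have h2 : (2 * lam) * (6 * M) ≤ (2 * lam) * A := by linarith
    exact le_of_mul_le_mul_left h2 (by positivity)
  have hMK : lam * (r + N) + eps ≤ M := by
    rw [hMdef, hKdef, mul_add lam (r + N) 1]; linarith
  have hk : ∀ j < N, A / (4 * lam) ≤ (y j).1 := by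
    intro j hj
    obtain ⟨hk1, hk2, hk3, hk4⟩ := hy j hj
    have key : ∀ x : H2R, dist (horiz x) w ≤ r → A / 2 ≤ dist (horiz (φ x)) m →
        v (y j).2 = vert x → A / 2 ≤ lam * (r + N + (y j).1) + eps + R := by
      intro x hx hxm hvx
      have h1 := dist_triangle (horiz (φ x)) (horiz (φ (Y j))) m
      have h2 := (vcb_horiz_le (φ x) (φ (Y j))).trans (hφ x (Y j)).2
      have h3 : dist x (Y j) ≤ r + N + (y j).1 := by
        refine (vcb_dist_le _ _).trans ?_
        simp only [Y, horiz_vcbPt, vert_vcbPt, hvx, sub_self, abs_zero, add_zero]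
        exact hray x hx j hj _
      have h4 : lam * dist x (Y j) ≤ lam * (r + N + (y j).1) := by gcongr
      have := hYm j hj
      linarith
    have key2 : A / 2 ≤ lam * (r + N + (y j).1) + eps + R := by
      rcases hk3 with h | h | h
      · rw [h]
        have : lam * D ≤ lam * L := by gcongr
        have : 0 ≤ lam * (r + N) := by positivity
        have : 0 ≤ lam * L := by positivity
        linarith
      · exact key p hpw ham (by rw [h, v0])
      · exact key q hqw hbm (by rw [h, vL])
    rw [div_le_iff₀ (by positivity)]
    linarith
  have hYY : ∀ j < N, ∀ k < N, j ≠ k →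
      A / (4 * lam ^ 2) ≤ |vert (φ (Y j)) - vert (φ (Y k))| := by
    intro j hj k hk' hjk
    have h1 := vcbRay_ne w j k hjk (y j).1 (y k).1 (Nat.cast_nonneg _)
    have h2 := vcb_horiz_le (Y j) (Y k)
    simp only [Y, horiz_vcbPt] at h2
    have h3 : A / (2 * lam) ≤ dist (Y j) (Y k) := by
      have := hk j hj
      have := hk k hk'
      have e : A / (2 * lam) = A / (4 * lam) + A / (4 * lam) := by field_simp; norm_num
      rw [e]
      linarith
    have h4 := (hφ (Y j) (Y k)).1
    have h5 : 1 / lam * (A / (2 * lam)) ≤ 1 / lam * dist (Y j) (Y k) := by gcongr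
    have h6 := vcb_dist_le (φ (Y j)) (φ (Y k))
    have h7 := dist_triangle_right (horiz (φ (Y j))) (horiz (φ (Y k))) m
    have h8 := hYm j hj
    have h9 := hYm k hk'
    have e1 : 1 / lam * (A / (2 * lam)) = 8 * R := by rw [hRdef]; field_simp; norm_num
    have e2 : A / (4 * lam ^ 2) = 4 * R := by rw [hRdef]; field_simp; norm_num
    have h10 : eps ≤ 2 * R := by
      have : 2 * R = A / (8 * lam ^ 2) := by rw [hRdef]; field_simp; norm_num
      rw [this, le_div_iff₀ (by positivity)]
      have h : (2 * lam) * (eps * (8 * lam ^ 2)) ≤ (2 * lam) * A := by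
        have : (2 * lam) * (eps * (8 * lam ^ 2)) = 16 * lam ^ 3 * eps := by ring
        linarith
      exact le_of_mul_le_mul_left h (by positivity)
    linarith
  have hYp : ∀ j < N, |vert (φ (Y j)) - vert (φ p)| ≤ 6 * lam ^ 2 * A := by
    intro j hj
    obtain ⟨hk1, hk2, -, -⟩ := hy j hj
    rw [abs_sub_comm]
    refine (vcb_vert_le _ _).trans ((hφ p (Y j)).2.trans ?_)
    have h1 : dist p (Y j) ≤ (r + N + (D + 1)) + D := by
      refine (vcb_dist_le _ _).trans ?_
      simp only [Y, horiz_vcbPt, vert_vcbPt]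
      have a1 := hray p hpw j hj (y j).1
      have a2 := hvp _ hk2
      have a3 : ((y j).1 : ℝ) ≤ L := by exact_mod_cast hk1
      linarith
    have h2 : lam * dist p (Y j) ≤ lam * ((r + N + (D + 1)) + D) := by gcongr
    have h3 : lam * ((r + N + (D + 1)) + D) + eps = M + 2 * (lam * D) := by
      rw [hMdef, hKdef]; ring
    have h4 : lam * D ≤ lam * (2 * lam * A) := by gcongr
    have h5 : M ≤ lam * D := by
      have b1 : lam * M ≤ lam * D := by
        have : 12 * lam * M = 12 * (lam * M) := by ring
        have : 0 ≤ lam * M := by positivity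
        have : D ≤ lam * D := le_mul_of_one_le_left (by linarith) hlam
        linarith
      exact (le_mul_of_one_le_left hM0.le hlam).trans b1
    have h6 : lam * (2 * lam * A) = 2 * (lam ^ 2 * A) := by ring
    linarith
  have hfin := vcb_pack N (fun j => vert (φ (Y j))) (vert (φ p)) (6 * lam ^ 2 * A)
    (A / (4 * lam ^ 2)) (by positivity) (by positivity) hYp hYY
  have e : 2 * (6 * lam ^ 2 * A) / (A / (4 * lam ^ 2)) = 48 * lam ^ 4 := by
    field_simp; norm_num
  rw [e] at hfin
  linarith
end

section
/- For all λ ≥ 1 and ε ≥ 0 there exists a constant L > 0, depending only on λ and ε, with the following property: let f : ℍ → ℍ be a (λ,ε)-quasi-isometric embedding and let g : ℍ → ℍ be a surjective isometry, and suppose f and g have the same boundary values in the sense that for every geodesic line γ : ℝ → ℍ (an isometric embedding of ℝ into ℍ) the sets f(γ(ℝ)) and g(γ(ℝ)) are at finite Hausdorff distance (there is M ≥ 0 such that every point of each of the two sets lies within distance M of the other set). Then dist(f(x), g(x)) ≤ L for all x ∈ ℍ. -/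
open UpperHalfPlane

/-- The vertical geodesic. -/
noncomputable def vline (t : ℝ) : ℍ := UpperHalfPlane.mk ⟨0, Real.exp t⟩ (Real.exp_pos t)

/-- log-modulus: coordinate of the projection onto the vertical line. -/
noncomputable def pcoord (z : ℍ) : ℝ := Real.log ‖(z : ℂ)‖

/-- Distance to the vertical line. -/
noncomputable def vdist (z : ℍ) : ℝ := dist z (vline (pcoord z))

lemma vline_isometry : Isometry vline := UpperHalfPlane.isometry_vertical_line 0

lemma norm_pos_uhp (z : ℍ) : 0 < ‖(z : ℂ)‖ := norm_pos_iff.2 z.ne_zero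

lemma exp_pcoord (z : ℍ) : Real.exp (pcoord z) = ‖(z : ℂ)‖ :=
  Real.exp_log (norm_pos_uhp z)

lemma norm_sq_uhp (z : ℍ) : ‖(z : ℂ)‖ ^ 2 = z.re ^ 2 + z.im ^ 2 := by
  rw [← Complex.normSq_eq_norm_sq, Complex.normSq_apply]
  simp only [UpperHalfPlane.coe_re, UpperHalfPlane.coe_im]; ring

lemma cosh_dist_re_im (z w : ℍ) :
    Real.cosh (dist z w) = 1 + ((z.re - w.re) ^ 2 + (z.im - w.im) ^ 2) / (2 * z.im * w.im) := by
  rw [UpperHalfPlane.cosh_dist, Complex.dist_eq, ← Complex.normSq_eq_norm_sq, Complex.normSq_apply]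
  simp only [Complex.sub_re, Complex.sub_im, UpperHalfPlane.coe_re, UpperHalfPlane.coe_im]
  ring

lemma cosh_dist_vline (z : ℍ) (t : ℝ) :
    Real.cosh (dist z (vline t)) =
      (‖(z : ℂ)‖ ^ 2 + Real.exp t ^ 2) / (2 * z.im * Real.exp t) := by
  have h1 : (vline t).re = 0 := rfl
  have h2 : (vline t).im = Real.exp t := rfl
  rw [cosh_dist_re_im, h1, h2, norm_sq_uhp]
  have := z.im_pos
  have := Real.exp_pos t
  field_simp
  ring

lemma cosh_vdist (z : ℍ) : Real.cosh (vdist z) = ‖(z : ℂ)‖ / z.im := by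
  rw [vdist, cosh_dist_vline, exp_pcoord]
  have := z.im_pos
  have := norm_pos_uhp z
  field_simp
  ring

lemma vdist_le (z : ℍ) (t : ℝ) : vdist z ≤ dist z (vline t) := by
  have h : Real.cosh (vdist z) ≤ Real.cosh (dist z (vline t)) := by
    rw [cosh_vdist, cosh_dist_vline]
    have := z.im_pos
    have := Real.exp_pos t
    rw [div_le_div_iff₀ (by positivity) (by positivity)]
    nlinarith [mul_nonneg z.im_pos.le (sq_nonneg (‖(z : ℂ)‖ - Real.exp t))]
  rw [Real.cosh_le_cosh, abs_of_nonneg dist_nonneg, abs_of_nonneg] at h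
  · exact h
  · exact dist_nonneg

lemma vdist_lip (z w : ℍ) : vdist z ≤ vdist w + dist z w := by
  have := vdist_le z (pcoord w)
  have h2 := dist_triangle z w (vline (pcoord w))
  unfold vdist at *
  linarith

lemma dist_le_vdist (z w : ℍ) : dist z w ≤ vdist z + vdist w + |pcoord z - pcoord w| := by
  have h := dist_triangle4 z (vline (pcoord z)) (vline (pcoord w)) w
  rw [vline_isometry.dist_eq, Real.dist_eq, dist_comm (vline (pcoord w)) w] at h
  unfold vdist
  linarith

lemma sq_half_le_cosh (x : ℝ) : x ^ 2 / 2 ≤ Real.cosh x - 1 := by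
  have h : Real.cosh x = 1 + 2 * Real.sinh (x / 2) ^ 2 := by
    have := Real.cosh_two_mul (x / 2)
    rw [Real.cosh_sq, mul_div_cancel₀ _ (two_ne_zero)] at this
    linarith
  have h2 : |x / 2| ≤ |Real.sinh (x / 2)| := by
    rw [Real.abs_sinh]
    exact Real.self_le_sinh_iff.2 (abs_nonneg _)
  have h3 := sq_le_sq.2 h2
  rw [h]
  nlinarith

lemma self_le_cosh (x : ℝ) : x ≤ Real.cosh x := by
  have := sq_half_le_cosh x
  nlinarith [sq_nonneg (x - 1)]

/-- Contraction of the projection far away from the line. -/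
lemma contraction (lam K R : ℝ) (hlam : 1 ≤ lam) (hR : 4 * lam * Real.cosh K ≤ R) (z w : ℍ)
    (hz : R ≤ vdist z) (hw : R ≤ vdist w) (hK : dist z w ≤ K) :
    |pcoord z - pcoord w| ≤ 1 / (2 * lam) := by
  have hu := sq_half_le_cosh (pcoord z - pcoord w)
  have hr := norm_pos_uhp z
  have hs := norm_pos_uhp w
  have hy := z.im_pos
  have hy' := w.im_pos
  have hK1 := Real.one_le_cosh K
  have e1 : Real.cosh (pcoord z - pcoord w) - 1 =
      (‖(z : ℂ)‖ - ‖(w : ℂ)‖) ^ 2 / (2 * ‖(z : ℂ)‖ * ‖(w : ℂ)‖) := by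
    rw [Real.cosh_eq, neg_sub, Real.exp_sub, Real.exp_sub, exp_pcoord, exp_pcoord]
    field_simp
    ring
  have hc : Real.cosh (dist z w) ≤ Real.cosh K := by
    rw [Real.cosh_le_cosh, abs_of_nonneg dist_nonneg]
    exact hK.trans (le_abs_self _)
  rw [UpperHalfPlane.cosh_dist, Complex.dist_eq] at hc
  have e2 : (‖(z : ℂ)‖ - ‖(w : ℂ)‖) ^ 2 ≤ ‖(z : ℂ) - w‖ ^ 2 := by
    rw [sq_le_sq, abs_of_nonneg (norm_nonneg ((z : ℂ) - w))]
    exact abs_norm_sub_norm_le _ _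
  have e3 : ‖(z : ℂ) - w‖ ^ 2 ≤ Real.cosh K * (2 * z.im * w.im) := by
    have : ‖(z : ℂ) - w‖ ^ 2 / (2 * z.im * w.im) ≤ Real.cosh K := by linarith
    rwa [div_le_iff₀ (by positivity)] at this
  have hRz : R * z.im ≤ ‖(z : ℂ)‖ := by
    have := hz.trans (self_le_cosh _)
    rwa [cosh_vdist, le_div_iff₀ hy] at this
  have hRw : R * w.im ≤ ‖(w : ℂ)‖ := by
    have := hw.trans (self_le_cosh _)
    rwa [cosh_vdist, le_div_iff₀ hy'] at this
  have hlK : 0 < lam * Real.cosh K := by positivity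
  have hR0 : 0 < R := by linarith
  have e4 : (R * z.im) * (R * w.im) ≤ ‖(z : ℂ)‖ * ‖(w : ℂ)‖ :=
    mul_le_mul hRz hRw (by positivity) hr.le
  have e5 : 16 * lam ^ 2 * Real.cosh K ≤ R ^ 2 := by
    have h1 : (4 * lam * Real.cosh K) ^ 2 ≤ R ^ 2 := by gcongr
    have h2 : Real.cosh K ≤ Real.cosh K ^ 2 := by nlinarith
    nlinarith [sq_nonneg lam, mul_le_mul_of_nonneg_left h2 (sq_nonneg lam)]
  have e6 : (‖(z : ℂ)‖ - ‖(w : ℂ)‖) ^ 2 / (2 * ‖(z : ℂ)‖ * ‖(w : ℂ)‖) ≤ 1 / (16 * lam ^ 2) := by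
    rw [div_le_div_iff₀ (by positivity) (by positivity)]
    have h3 : (16 * lam ^ 2 * Real.cosh K) * (z.im * w.im) ≤ R ^ 2 * (z.im * w.im) := by gcongr
    have h4 : (‖(z : ℂ)‖ - ‖(w : ℂ)‖) ^ 2 * (16 * lam ^ 2) ≤
        Real.cosh K * (2 * z.im * w.im) * (16 * lam ^ 2) := by
      gcongr
      exact e2.trans e3
    nlinarith
  have e7 : (pcoord z - pcoord w) ^ 2 ≤ (1 / (2 * lam)) ^ 2 := by
    have : (1 / (2 * lam)) ^ 2 = 4 * (1 / (16 * lam ^ 2)) := by field_simp; norm_num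
    have h0 : 0 < 1 / (16 * lam ^ 2) := by positivity
    linarith
  exact abs_le_of_sq_le_sq e7 (by positivity)

lemma chain (lam eps R : ℝ) (hlam : 1 ≤ lam)
    (hR : 4 * lam * Real.cosh (lam + eps) ≤ R) (c : ℝ → ℍ) (hc : IsQIE lam eps c) (t : ℝ) (n : ℕ)
    (h : ∀ i : ℕ, i ≤ n → R ≤ vdist (c (t + i))) :
    |pcoord (c t) - pcoord (c (t + n))| ≤ n * (1 / (2 * lam)) := by
  induction n with
  | zero => simp
  | succ n ih =>
    have h1 := ih (fun i hi => h i (by omega))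
    have h2 := contraction lam (lam + eps) R hlam hR (c (t + n)) (c (t + (n + 1 : ℕ)))
      (h n (by omega)) (h _ le_rfl) (by
        have := (hc (t + n) (t + (n + 1 : ℕ))).2
        rw [Real.dist_eq] at this
        have e : |t + (n : ℝ) - (t + ((n + 1 : ℕ) : ℝ))| = 1 := by
          push_cast
          rw [show t + (n : ℝ) - (t + (n + 1)) = -1 by ring]; simp
        rw [e, mul_one] at this
        exact this)
    have h3 := abs_sub_le (pcoord (c t)) (pcoord (c (t + n))) (pcoord (c (t + (n + 1 : ℕ))))
    push_cast at *
    linarith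

/-- An excursion with controlled endpoints is short. -/
lemma excursion (lam eps R : ℝ) (hlam : 1 ≤ lam)
    (hR : 4 * lam * Real.cosh (lam + eps) ≤ R) (c : ℝ → ℍ) (hc : IsQIE lam eps c) (t : ℝ) (n : ℕ)
    (h : ∀ i : ℕ, i ≤ n → R ≤ vdist (c (t + i))) (A : ℝ)
    (h0 : vdist (c t) ≤ A) (hn : vdist (c (t + n)) ≤ A) :
    (n : ℝ) ≤ 2 * lam * (2 * A + eps) := by
  have h1 := chain lam eps R hlam hR c hc t n h
  have h2 := dist_le_vdist (c t) (c (t + n))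
  have h3 := (hc t (t + n)).1
  rw [Real.dist_eq, show t - (t + n) = -(n : ℝ) by ring, abs_neg,
    abs_of_nonneg (Nat.cast_nonneg n)] at h3
  have h4 : (n : ℝ) * (1 / (2 * lam)) ≤ 2 * A + eps := by
    have : 1 / lam * (n : ℝ) = 2 * (n * (1 / (2 * lam))) := by field_simp
    linarith
  rw [mul_one_div, div_le_iff₀ (by positivity)] at h4
  linarith

lemma returns (lam eps R : ℝ) (hlam : 1 ≤ lam)
    (hR : 4 * lam * Real.cosh (lam + eps) ≤ R) (c : ℝ → ℍ) (hc : IsQIE lam eps c) (M : ℝ)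
    (hM : ∀ t, vdist (c t) ≤ M) : ∃ n : ℕ, vdist (c n) ≤ R := by
  by_contra! hcon
  obtain ⟨n, hn⟩ := exists_nat_gt (2 * lam * (2 * M + eps))
  have := excursion lam eps R hlam hR c hc 0 n (fun i _ => by rw [zero_add]; exact (hcon i).le) M
    (hM _) (hM _)
  linarith

lemma morse (lam eps : ℝ) (hlam : 1 ≤ lam) (heps : 0 ≤ eps) :
    ∃ D : ℝ, ∀ c : ℝ → ℍ, IsQIE lam eps c → (∃ M, ∀ t, vdist (c t) ≤ M) → vdist (c 0) ≤ D := by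
  set R := 4 * lam * Real.cosh (lam + eps) with hRdef
  have hR : 4 * lam * Real.cosh (lam + eps) ≤ R := le_rfl
  set A := R + (lam + eps) with hA
  set T := 2 * lam * (2 * A + eps) with hT
  have hR0 : 0 < R := by
    have := Real.cosh_pos (lam + eps)
    positivity
  have hA0 : 0 < A := by positivity
  have hT0 : 0 < T := by positivity
  refine ⟨A + (lam * T + eps), ?_⟩
  rintro c hc ⟨M, hM⟩
  have hstep : ∀ s t : ℝ, |s - t| = 1 → vdist (c s) ≤ vdist (c t) + (lam + eps) := by
    intro s t hst
    have h1 := vdist_lip (c s) (c t)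
    have h2 := (hc s t).2
    rw [Real.dist_eq, hst] at h2
    linarith
  by_cases h0 : vdist (c 0) ≤ R
  · have : 0 < lam * T := by positivity
    linarith
  have hex1 := returns lam eps R hlam hR c hc M hM
  have hc' : IsQIE lam eps (fun t => c (-t)) := by
    intro x y
    have := hc (-x) (-y)
    rwa [dist_neg_neg] at this
  have hex2 := returns lam eps R hlam hR (fun t => c (-t)) hc' M (fun t => hM _)
  classical
  obtain ⟨b, hb, hbmin⟩ : ∃ b : ℕ, vdist (c b) ≤ R ∧ ∀ m < b, ¬ vdist (c m) ≤ R :=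
    ⟨Nat.find hex1, Nat.find_spec hex1, fun m hm => Nat.find_min hex1 hm⟩
  obtain ⟨a, ha, hamin⟩ : ∃ b : ℕ, vdist (c (-b)) ≤ R ∧ ∀ m : ℕ, m < b → ¬ vdist (c (-m)) ≤ R :=
    ⟨Nat.find hex2, Nat.find_spec hex2, fun m hm => Nat.find_min hex2 hm⟩
  obtain _ | b := b
  · simp at hb; exact absurd hb h0
  obtain _ | a := a
  · simp at ha; exact absurd ha h0
  have hbA : vdist (c b) ≤ A := by
    have := hstep b (b + 1 : ℕ) (by push_cast; rw [show (b : ℝ) - (b + 1) = -1 by ring]; simp)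
    linarith
  have haA : vdist (c (-a)) ≤ A := by
    have := hstep (-a) (-(a + 1 : ℕ)) (by
      push_cast; rw [show -(a : ℝ) - -(a + 1) = 1 by ring]; simp)
    linarith
  have hlen := excursion lam eps R hlam hR c hc (-a) (a + b) (by
    intro i hi
    by_cases hia : i ≤ a
    · have := hamin (a - i) (by omega)
      rw [Nat.cast_sub hia, show -((a : ℝ) - i) = -a + i by ring] at this
      exact (not_le.1 this).le
    · have := hbmin (i - a) (by omega)
      rw [Nat.cast_sub (by omega), show ((i : ℝ) - a) = -a + i by ring] at this
      exact (not_le.1 this).le) A haA (by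
    push_cast; rw [show -(a : ℝ) + (a + b) = b by ring]; exact hbA)
  have h1 := vdist_lip (c 0) (c b)
  have h2 := (hc 0 b).2
  rw [Real.dist_eq, zero_sub, abs_neg, abs_of_nonneg (Nat.cast_nonneg b)] at h2
  push_cast at hlen
  have h3 : (b : ℝ) ≤ T := by
    have : (0 : ℝ) ≤ a := Nat.cast_nonneg a
    linarith
  have h4 : lam * b ≤ lam * T := by gcongr
  linarith

/-- Quarter turn about `I`. -/
noncomputable def qturn : Matrix.SpecialLinearGroup (Fin 2) ℝ :=
  ⟨!![√2 / 2, -(√2 / 2); √2 / 2, √2 / 2], by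
    rw [Matrix.det_fin_two_of]
    have := Real.sq_sqrt (show (0 : ℝ) ≤ 2 by norm_num)
    nlinarith⟩

lemma qturn_mul (w : ℍ) : ((qturn • w : ℍ) : ℂ) * (w + 1) = w - 1 := by
  have hs : ((√2 : ℝ) : ℂ) ≠ 0 := by
    norm_cast; positivity
  have hw : (w : ℂ) + 1 ≠ 0 := by
    intro h
    have := congrArg Complex.im h
    simp at this
    exact w.im_ne_zero this
  have hd : ((√2 : ℝ) : ℂ) / 2 * w + (√2 : ℝ) / 2 ≠ 0 := by
    rw [show ((√2 : ℝ) : ℂ) / 2 * w + (√2 : ℝ) / 2 = (√2 : ℝ) / 2 * ((w : ℂ) + 1) by ring]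
    exact mul_ne_zero (div_ne_zero hs two_ne_zero) hw
  rw [UpperHalfPlane.coe_specialLinearGroup_apply]
  simp only [qturn, Matrix.SpecialLinearGroup.coe_mk, Matrix.of_apply, Matrix.cons_val', 
    Matrix.cons_val_zero, Matrix.cons_val_one, Algebra.algebraMap_self, RingHom.id_apply,
    Matrix.cons_val_fin_one]
  push_cast
  field_simp
  ring

lemma qturn_I : qturn • UpperHalfPlane.I = UpperHalfPlane.I := by
  have h := qturn_mul UpperHalfPlane.I
  have hw : (UpperHalfPlane.I : ℂ) + 1 ≠ 0 := by
    intro h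
    have := congrArg Complex.im h
    simp at this
  apply UpperHalfPlane.ext
  apply mul_right_cancel₀ hw
  rw [h]
  simp only [UpperHalfPlane.coe_I]
  linear_combination -Complex.I_sq

lemma near_both (D : ℝ) (w : ℍ) (h1 : vdist w ≤ D) (h2 : vdist (qturn • w) ≤ D) :
    dist w UpperHalfPlane.I ≤ 4 * Real.cosh D := by
  have key : ∀ z : ℍ, vdist z ≤ D → z.re ^ 2 + z.im ^ 2 ≤ Real.cosh D ^ 2 * z.im ^ 2 := by
    intro z hz
    have h : Real.cosh (vdist z) ≤ Real.cosh D := by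
      rw [Real.cosh_le_cosh, abs_of_nonneg (show 0 ≤ vdist z from dist_nonneg)]
      exact hz.trans (le_abs_self _)
    rw [cosh_vdist, div_le_iff₀ z.im_pos] at h
    rw [← norm_sq_uhp, ← mul_pow]
    gcongr
  have k1 := key w h1
  have k2 := key _ h2
  have hm := qturn_mul w
  have m1 := congrArg Complex.re hm
  have m2 := congrArg Complex.im hm
  have hC := Real.one_le_cosh D
  have hq := (qturn • w).im_pos
  have hy := w.im_pos
  simp only [Complex.mul_re, Complex.mul_im, Complex.add_re, Complex.add_im, Complex.sub_re,
    Complex.sub_im, Complex.one_re, Complex.one_im, UpperHalfPlane.coe_re,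
    UpperHalfPlane.coe_im, add_zero, sub_zero] at m1 m2
  refine (self_le_cosh _).trans ?_
  rw [cosh_dist_re_im, UpperHalfPlane.I_re, UpperHalfPlane.I_im]
  generalize (qturn • w).re = p at *
  generalize (qturn • w).im = q at *
  generalize w.re = x at *
  generalize w.im = y at *
  generalize Real.cosh D = C at *
  set N := (x + 1) ^ 2 + y ^ 2 with hN
  have a1 : q * N = 2 * y := by
    rw [hN]; linear_combination (x + 1) * m2 - y * m1
  have a2 : p * N = x ^ 2 + y ^ 2 - 1 := by
    rw [hN]; linear_combination (x + 1) * m1 + y * m2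
  have a3 : (x ^ 2 + y ^ 2 - 1) ^ 2 ≤ (2 * C * y) ^ 2 := by
    have : (p ^ 2 + q ^ 2) * N ^ 2 ≤ C ^ 2 * q ^ 2 * N ^ 2 := by gcongr
    have e : C ^ 2 * q ^ 2 * N ^ 2 = (2 * C * y) ^ 2 := by
      rw [show C ^ 2 * q ^ 2 * N ^ 2 = C ^ 2 * (q * N) ^ 2 by ring, a1]; ring
    have e2 : (p ^ 2 + q ^ 2) * N ^ 2 = (p * N) ^ 2 + (q * N) ^ 2 := by ring
    rw [e, e2, a2] at this
    nlinarith [sq_nonneg (q * N)]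
  have a4 := abs_le.1 (abs_le_of_sq_le_sq a3 (by positivity))
  have a5 : 1 ≤ 3 * C * y := by
    by_contra! hlt
    have : 0 < C * y := by positivity
    nlinarith
  have e : 1 + ((x - 0) ^ 2 + (y - 1) ^ 2) / (2 * y * 1) = (x ^ 2 + y ^ 2 + 1) / (2 * y) := by
    field_simp; ring
  rw [e, div_le_iff₀ (by positivity)]
  nlinarith

/-- A quasi-isometric embedding of `ℍ` with the same boundary values as an isometry
(meaning: images of every geodesic line are at finite Hausdorff distance) stays within a
uniformly bounded distance `L` of that isometry, `L` depending only on `λ` and `ε`. -/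
theorem qie_close_to_isometry (lam eps : ℝ) (hlam : 1 ≤ lam) (heps : 0 ≤ eps) :
    ∃ L > (0 : ℝ), ∀ f g : UpperHalfPlane → UpperHalfPlane,
      IsQIE lam eps f → Isometry g → Function.Surjective g →
      (∀ γ : ℝ → UpperHalfPlane, Isometry γ →
        ∃ M ≥ (0 : ℝ),
          (∀ t : ℝ, ∃ t' : ℝ, dist (f (γ t)) (g (γ t')) ≤ M) ∧
          (∀ t : ℝ, ∃ t' : ℝ, dist (g (γ t)) (f (γ t')) ≤ M)) →
      ∀ x : UpperHalfPlane, dist (f x) (g x) ≤ L := by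
  obtain ⟨D, hD⟩ := morse lam eps hlam heps
  refine ⟨4 * Real.cosh D, by have := Real.cosh_pos D; positivity, ?_⟩
  intro f g hf hg hgs hline x
  choose gi hgi using hgs
  let G : ℍ ≃ᵢ ℍ := IsometryEquiv.mk' g gi hgi hg
  have hG : ∀ z, G z = g z := fun _ => rfl
  have key : ∀ e : ℍ ≃ᵢ ℍ, vdist (e.symm (G.symm (f (e (vline 0))))) ≤ D := by
    intro e
    apply hD (fun t => e.symm (G.symm (f (e (vline t)))))
    · intro s t
      have := hf (e (vline s)) (e (vline t))
      rw [e.dist_eq, vline_isometry.dist_eq] at this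
      rwa [e.symm.dist_eq, G.symm.dist_eq]
    · obtain ⟨M, -, hM, -⟩ := hline (fun t => e (vline t)) (e.isometry.comp vline_isometry)
      refine ⟨M, fun t => ?_⟩
      obtain ⟨t', ht'⟩ := hM t
      refine (vdist_le _ t').trans ?_
      rw [← e.dist_eq, e.apply_symm_apply, ← G.dist_eq, G.apply_symm_apply, hG]
      exact ht'
  have hv : vline 0 = UpperHalfPlane.I := by
    apply UpperHalfPlane.ext_re_im
    · rw [UpperHalfPlane.I_re]; rfl
    · rw [UpperHalfPlane.I_im]; exact Real.exp_zero
  obtain ⟨a, ha⟩ := MulAction.exists_smul_eq (Matrix.SpecialLinearGroup (Fin 2) ℝ)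
    UpperHalfPlane.I x
  have k1 := key (IsometryEquiv.constSMul a)
  have k2 := key (IsometryEquiv.constSMul (a * qturn⁻¹))
  have hqi : qturn⁻¹ • UpperHalfPlane.I = UpperHalfPlane.I := by
    rw [inv_smul_eq_iff, qturn_I]
  rw [hv, IsometryEquiv.constSMul_symm, IsometryEquiv.constSMul_apply,
    IsometryEquiv.constSMul_apply] at k1 k2
  rw [mul_inv_rev, inv_inv, mul_smul, mul_smul, hqi] at k2
  rw [ha] at k1 k2
  have := near_both D _ k1 k2
  rw [← ha, ← dist_smul a, smul_inv_smul, ha, ← G.dist_eq, G.apply_symm_apply, hG] at this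
  exact this
end

section
/- Let H be a subgroup of PSL(2,ℝ) and let Ĥ ≤ SL(2,ℝ) be the full preimage of H under the quotient map SL(2,ℝ) → PSL(2,ℝ). Suppose that: (i) no point z of the upper half-plane ℍ is fixed by every element of Ĥ under the Möbius action of SL(2,ℝ) on ℍ; (ii) no 1-dimensional linear subspace of ℝ² is mapped to itself by every element of Ĥ; and (iii) no unordered pair of two distinct 1-dimensional linear subspaces of ℝ² is mapped to itself (setwise) by every element of Ĥ. Then either H is discrete (the subspace topology on H is discrete) or the underlying set of H is dense in PSL(2,ℝ). -/
open UpperHalfPlane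

/-- `SL(2,ℝ)`. -/
abbrev SL2R := Matrix.SpecialLinearGroup (Fin 2) ℝ

/-- The topology on `SL(2,ℝ)` induced from the 2×2 real matrices. -/
noncomputable instance : TopologicalSpace SL2R :=
  TopologicalSpace.induced (fun g => (g : Matrix (Fin 2) (Fin 2) ℝ)) inferInstance

/-- `PSL(2,ℝ)` as the quotient of `SL(2,ℝ)` by its center. -/
abbrev PSL2R := SL2R ⧸ Subgroup.center SL2R

open Matrix

theorem aux_finrank_ker (A : Matrix (Fin 2) (Fin 2) ℝ) (hA : A ≠ 0) (hd : A.det = 0) :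
    Module.finrank ℝ (LinearMap.ker (Matrix.toLin' A)) = 1 := by
  have h1 : LinearMap.ker (Matrix.toLin' A) ≠ ⊥ := by
    intro h
    obtain ⟨v, hv, hv0⟩ := Matrix.exists_mulVec_eq_zero_iff.2 hd
    have : v ∈ LinearMap.ker (Matrix.toLin' A) := by simpa using hv0
    rw [h] at this
    exact hv (by simpa using this)
  have h2 : LinearMap.ker (Matrix.toLin' A) ≠ ⊤ := by
    intro h
    rw [LinearMap.ker_eq_top] at h
    exact hA (by simpa using h)
  have h3 := Submodule.finrank_lt h2
  have h4 : Module.finrank ℝ (LinearMap.ker (Matrix.toLin' A)) ≠ 0 := by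
    intro h; exact h1 (Submodule.finrank_eq_zero.1 h)
  simp at h3
  omega

theorem aux_map_eq (g : SL2R) (W W' : Submodule ℝ (Fin 2 → ℝ)) (hW : Module.finrank ℝ W = 1)
    (hW' : Module.finrank ℝ W' = 1)
    (h : ∀ v ∈ W, Matrix.toLin' (g : Matrix (Fin 2) (Fin 2) ℝ) v ∈ W') :
    W.map (Matrix.toLin' (g : Matrix (Fin 2) (Fin 2) ℝ)) = W' := by
  apply Submodule.eq_of_le_of_finrank_eq
  · rintro _ ⟨v, hv, rfl⟩
    exact h v hv
  · rw [hW', ← hW]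
    have hinj : Function.Injective (Matrix.toLin' (g : Matrix (Fin 2) (Fin 2) ℝ)) := by
      rw [Matrix.toLin'_apply']
      apply Matrix.mulVec_injective_of_isUnit
      rw [Matrix.isUnit_iff_isUnit_det]
      simp
    exact (LinearEquiv.finrank_eq (Submodule.equivMapOfInjective _ hinj W)).symm

theorem aux_unique (p q r : ℝ) (hr : r ≠ 0) (z : UpperHalfPlane)
    (hz : (r : ℂ) * z ^ 2 - 2 * p * z - q = 0) :
    z.re = p / r ∧ z.im ^ 2 = (-p ^ 2 - q * r) / r ^ 2 := by
  have him := z.im_pos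
  have e1 := congrArg Complex.re hz
  have e2 := congrArg Complex.im hz
  simp [pow_two] at e1 e2
  have h1 : z.re = p / r := by
    have : z.im * (r * z.re - p) = 0 := by linarith
    rcases mul_eq_zero.1 this with h | h
    · exact absurd h him.ne'
    · field_simp; linarith
  refine ⟨h1, ?_⟩
  have h2 : r * z.re = p := by rw [h1]; field_simp
  field_simp
  have h3 : r * (r * (z.re * z.re - z.im * z.im) - 2 * p * z.re - q) = 0 := by
    rw [e1, mul_zero]
  linear_combination -h3 + (r * z.re - p) * h2

theorem aux_invariant (G : Subgroup SL2R)
    (h1 : ¬ ∃ z : UpperHalfPlane, ∀ g ∈ G, g • z = z)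
    (h2 : ¬ ∃ W : Submodule ℝ (Fin 2 → ℝ), Module.finrank ℝ W = 1 ∧
      ∀ g ∈ G, W.map (Matrix.toLin' (g : Matrix (Fin 2) (Fin 2) ℝ)) = W)
    (h3 : ¬ ∃ W₁ W₂ : Submodule ℝ (Fin 2 → ℝ),
      Module.finrank ℝ W₁ = 1 ∧ Module.finrank ℝ W₂ = 1 ∧ W₁ ≠ W₂ ∧
      ∀ g ∈ G,
        (W₁.map (Matrix.toLin' (g : Matrix (Fin 2) (Fin 2) ℝ)) = W₁ ∧
          W₂.map (Matrix.toLin' (g : Matrix (Fin 2) (Fin 2) ℝ)) = W₂) ∨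
        (W₁.map (Matrix.toLin' (g : Matrix (Fin 2) (Fin 2) ℝ)) = W₂ ∧
          W₂.map (Matrix.toLin' (g : Matrix (Fin 2) (Fin 2) ℝ)) = W₁))
    (X : Matrix (Fin 2) (Fin 2) ℝ) (hX : X ≠ 0) (htr : X 1 1 = - X 0 0)
    (hinv : ∀ g ∈ G, ∃ c : ℝ, X * (g : Matrix (Fin 2) (Fin 2) ℝ) =
      c • ((g : Matrix (Fin 2) (Fin 2) ℝ) * X)) : False := by
  rcases lt_trichotomy X.det 0 with hd | hd | hd
  · -- hyperbolic case
    set l := Real.sqrt (-X.det) with hl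
    have hlpos : 0 < l := Real.sqrt_pos.2 (by linarith)
    have hl2 : l ^ 2 = -X.det := Real.sq_sqrt (by linarith)
    have hk : ∀ s : ℝ, s ^ 2 = l ^ 2 → s ≠ 0 → 
        Module.finrank ℝ (LinearMap.ker (Matrix.toLin' (X - s • (1 : Matrix (Fin 2) (Fin 2) ℝ)))) = 1 := by
      intro s hs hs0
      apply aux_finrank_ker
      · intro h
        have e1 := congrFun (congrFun h 0) 0
        have e2 := congrFun (congrFun h 1) 1
        simp [htr] at e1 e2
        exact hs0 (by linarith)
      · rw [hl2] at hs
        rw [Matrix.det_fin_two] at hs ⊢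
        simp [htr] at hs ⊢
        linarith
    have hmem : ∀ (s : ℝ) v, v ∈ LinearMap.ker (Matrix.toLin' (X - s • (1 : Matrix (Fin 2) (Fin 2) ℝ))) ↔
        X *ᵥ v = s • v := by
      intro s v
      rw [LinearMap.mem_ker, Matrix.toLin'_apply, Matrix.sub_mulVec, Matrix.smul_mulVec,
        Matrix.one_mulVec, sub_eq_zero]
    have kp := hk l rfl hlpos.ne'
    have km := hk (-l) (by ring) (by linarith)
    refine h3 ⟨_, _, kp, km, ?_, ?_⟩
    · intro heq
      have : LinearMap.ker (Matrix.toLin' (X - l • (1 : Matrix (Fin 2) (Fin 2) ℝ))) = ⊥ := by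
        rw [eq_bot_iff]
        intro v hv
        have a1 := (hmem _ _).1 hv
        rw [heq] at hv
        have a2 := (hmem _ _).1 hv
        rw [a1] at a2
        have : (2 * l) • v = 0 := by
          rw [two_mul, add_smul]; nth_rewrite 1 [a2]; simp
        simpa [hlpos.ne'] using this
      rw [this] at kp
      simp at kp
    · intro g hg
      obtain ⟨c, hc⟩ := hinv g hg
      have hc2 : c ^ 2 = 1 := by
        have := congrArg Matrix.det hc
        rw [Matrix.det_smul, Matrix.det_mul, Matrix.det_mul] at this
        simp at this
        exact mul_right_cancel₀ hd.ne (by rw [← this]; ring)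
      have step : ∀ s v, X *ᵥ v = s • v → X *ᵥ (g.1 *ᵥ v) = (c * s) • (g.1 *ᵥ v) := by
        intro s v hv
        rw [Matrix.mulVec_mulVec, hc, Matrix.smul_mulVec, ← Matrix.mulVec_mulVec, hv,
          Matrix.mulVec_smul, smul_smul]
      rcases (sq_eq_sq_iff_eq_or_eq_neg.1 (hc2.trans (one_pow 2).symm)) with rfl | rfl
      · left
        refine ⟨aux_map_eq g _ _ kp kp ?_, aux_map_eq g _ _ km km ?_⟩
        all_goals
          intro v hv
          rw [hmem] at hv ⊢
          simpa using step _ _ hv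
      · right
        refine ⟨aux_map_eq g _ _ kp km ?_, aux_map_eq g _ _ km kp ?_⟩
        all_goals
          intro v hv
          rw [hmem] at hv ⊢
          simpa using step _ _ hv
  · -- parabolic case
    have kp := aux_finrank_ker X hX hd
    refine h2 ⟨_, kp, fun g hg => aux_map_eq g _ _ kp kp fun v hv => ?_⟩
    obtain ⟨c, hc⟩ := hinv g hg
    simp only [LinearMap.mem_ker, Matrix.toLin'_apply] at hv ⊢
    rw [Matrix.mulVec_mulVec, hc, Matrix.smul_mulVec, ← Matrix.mulVec_mulVec, hv]
    simp
  · -- elliptic case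
    set p := X 0 0 with hp
    set q := X 0 1 with hq
    set r := X 1 0 with hr
    have hd' : 0 < -p ^ 2 - q * r := by
      rw [Matrix.det_fin_two, htr] at hd; nlinarith
    have hr0 : r ≠ 0 := by
      intro h; rw [h] at hd'; nlinarith [sq_nonneg p]
    set e := Real.sqrt (-p ^ 2 - q * r) with he
    have hepos : 0 < e := Real.sqrt_pos.2 hd'
    have he2 : e ^ 2 = -p ^ 2 - q * r := Real.sq_sqrt hd'.le
    let z : UpperHalfPlane := ⟨⟨p / r, e / |r|⟩, by
      show 0 < e / |r|
      positivity⟩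
    have hzre : (z : ℂ).re = p / r := rfl
    have hzim : (z : ℂ).im = e / |r| := rfl
    have hz : (r : ℂ) * z ^ 2 - 2 * p * z - q = 0 := by
      apply Complex.ext
      · have : (e / |r|) * (e / |r|) = e ^ 2 / r ^ 2 := by
          rw [div_mul_div_comm, abs_mul_abs_self]; ring
        simp only [pow_two, Complex.sub_re, Complex.mul_re, Complex.ofReal_re, Complex.ofReal_im,
          Complex.mul_im, hzre, hzim, Complex.re_ofNat, Complex.im_ofNat, Complex.zero_re]
        rw [this, he2]
        field_simp
        ring
      · simp only [pow_two, Complex.sub_im, Complex.mul_re, Complex.ofReal_re, Complex.ofReal_im,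
          Complex.mul_im, hzre, hzim, Complex.re_ofNat, Complex.im_ofNat, Complex.zero_im]
        field_simp
        ring
    refine h1 ⟨z, fun g hg => ?_⟩
    obtain ⟨k, hk⟩ := hinv g hg
    have hw : (r : ℂ) * (g • z : UpperHalfPlane) ^ 2 - 2 * p * (g • z : UpperHalfPlane) - q = 0 := by
      have hdet : ((g 0 0 : ℝ) : ℂ) * (g 1 1 : ℝ) - (g 0 1 : ℝ) * (g 1 0 : ℝ) = 1 := by
        have := g.det_coe
        rw [Matrix.det_fin_two] at this
        exact_mod_cast this
      have E : ∀ i j, ((X * g.1) i j : ℂ) = ((k • (g.1 * X)) i j : ℝ) := by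
        intro i j; rw [hk]
      have E00 := E 0 0
      have E01 := E 0 1
      have E10 := E 1 0
      have E11 := E 1 1
      simp only [Matrix.mul_apply, Fin.sum_univ_two, Matrix.smul_apply, htr, ← hp, ← hq, ← hr,
        smul_eq_mul] at E00 E01 E10 E11
      push_cast at E00 E01 E10 E11
      have hden := UpperHalfPlane.denom_ne_zero g z
      rw [UpperHalfPlane.coe_specialLinearGroup_apply]
      simp only [UpperHalfPlane.denom] at hden
      have hden' : ((g 1 0 : ℝ) : ℂ) * z + (g 1 1 : ℝ) ≠ 0 := hden
      change (r : ℂ) * (((g 0 0 : ℝ) * z + (g 0 1 : ℝ) : ℂ) / ((g 1 0 : ℝ) * z + (g 1 1 : ℝ) : ℂ)) ^ 2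
        - 2 * p * (((g 0 0 : ℝ) * z + (g 0 1 : ℝ) : ℂ) / ((g 1 0 : ℝ) * z + (g 1 1 : ℝ) : ℂ)) - q = 0
      have hmain : (r : ℂ) * ((g 0 0 : ℝ) * z + (g 0 1 : ℝ) : ℂ) ^ 2
          - 2 * p * ((g 0 0 : ℝ) * z + (g 0 1 : ℝ) : ℂ) * ((g 1 0 : ℝ) * z + (g 1 1 : ℝ) : ℂ)
          - q * ((g 1 0 : ℝ) * z + (g 1 1 : ℝ) : ℂ) ^ 2 = 0 := by
        linear_combination ((g 0 0 : ℝ) * z + (g 0 1 : ℝ) : ℂ) * (z * E10 + E11)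
          - ((g 1 0 : ℝ) * z + (g 1 1 : ℝ) : ℂ) * (z * E00 + E01)
          + k * ((g 0 0 : ℝ) * (g 1 1 : ℝ) - (g 0 1 : ℝ) * (g 1 0 : ℝ) : ℂ) * hz
      generalize ((g 0 0 : ℝ) * z + (g 0 1 : ℝ) : ℂ) = n at hmain ⊢
      generalize ((g 1 0 : ℝ) * z + (g 1 1 : ℝ) : ℂ) = m at hmain hden' ⊢
      have hfrac : (r : ℂ) * (n / m) ^ 2 - 2 * p * (n / m) - q =
          (r * n ^ 2 - 2 * p * n * m - q * m ^ 2) / m ^ 2 := by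
        field_simp
      rw [hfrac, hmain, zero_div]
    obtain ⟨a1, a2⟩ := aux_unique p q r hr0 _ hz
    obtain ⟨b1, b2⟩ := aux_unique p q r hr0 _ hw
    apply UpperHalfPlane.ext
    apply Complex.ext
    · exact b1.trans a1.symm
    · have := b2.trans a2.symm
      exact (pow_left_inj₀ (g • z).im_pos.le z.im_pos.le two_ne_zero).1 this

theorem aux_cross (u1 u2 u3 v1 v2 v3 : ℝ) (hu : ¬ (u1 = 0 ∧ u2 = 0 ∧ u3 = 0))
    (c1 : u2 * v3 - u3 * v2 = 0) (c2 : u3 * v1 - u1 * v3 = 0) (c3 : u1 * v2 - u2 * v1 = 0) :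
    ∃ k : ℝ, v1 = k * u1 ∧ v2 = k * u2 ∧ v3 = k * u3 := by
  by_cases h1 : u1 = 0
  · by_cases h2 : u2 = 0
    · have h3 : u3 ≠ 0 := fun h => hu ⟨h1, h2, h⟩
      refine ⟨v3 / u3, ?_, ?_, ?_⟩ <;> field_simp <;> linarith
    · refine ⟨v2 / u2, ?_, ?_, ?_⟩ <;> field_simp <;> linarith
  · refine ⟨v1 / u1, ?_, ?_, ?_⟩ <;> field_simp <;> linarith

theorem aux_prop (u1 u2 u3 v1 v2 v3 y1 y2 y3 w1 w2 w3 : ℝ)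
    (hu : ¬ (u1 = 0 ∧ u2 = 0 ∧ u3 = 0)) (hy : ¬ (y1 = 0 ∧ y2 = 0 ∧ y3 = 0))
    (a1 : y1 * u1 + y2 * u2 + y3 * u3 = 0) (a2 : y1 * v1 + y2 * v2 + y3 * v3 = 0)
    (b1 : w1 * u1 + w2 * u2 + w3 * u3 = 0) (b2 : w1 * v1 + w2 * v2 + w3 * v3 = 0) :
    (∃ k : ℝ, v1 = k * u1 ∧ v2 = k * u2 ∧ v3 = k * u3) ∨
    (∃ k : ℝ, w1 = k * y1 ∧ w2 = k * y2 ∧ w3 = k * y3) := by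
  by_cases hn : (u2 * v3 - u3 * v2 = 0) ∧ (u3 * v1 - u1 * v3 = 0) ∧ (u1 * v2 - u2 * v1 = 0)
  · exact Or.inl (aux_cross _ _ _ _ _ _ hu hn.1 hn.2.1 hn.2.2)
  · right
    obtain ⟨k, e1, e2, e3⟩ := aux_cross _ _ _ y1 y2 y3 hn
      (by linear_combination v1 * a1 - u1 * a2) (by linear_combination v2 * a1 - u2 * a2)
      (by linear_combination v3 * a1 - u3 * a2)
    obtain ⟨m, f1, f2, f3⟩ := aux_cross _ _ _ w1 w2 w3 hn
      (by linear_combination v1 * b1 - u1 * b2) (by linear_combination v2 * b1 - u2 * b2)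
      (by linear_combination v3 * b1 - u3 * b2)
    have hk : k ≠ 0 := by
      rintro rfl; exact hy ⟨by simpa using e1, by simpa using e2, by simpa using e3⟩
    refine ⟨m / k, ?_, ?_, ?_⟩
    · rw [f1, e1]; field_simp
    · rw [f2, e2]; field_simp
    · rw [f3, e3]; field_simp

theorem aux_span (G : Subgroup SL2R) (V : Submodule ℝ (Matrix (Fin 2) (Fin 2) ℝ)) (hV : V ≠ ⊤)
    (hone : (1 : Matrix (Fin 2) (Fin 2) ℝ) ∈ V)
    (X : Matrix (Fin 2) (Fin 2) ℝ) (hXV : X ∈ V)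
    (hX : ∀ c : ℝ, X ≠ c • (1 : Matrix (Fin 2) (Fin 2) ℝ))
    (hinv : ∀ g ∈ G, ∀ A ∈ V, (g⁻¹).1 * A * g.1 ∈ V) :
    ∃ X : Matrix (Fin 2) (Fin 2) ℝ, X ≠ 0 ∧ X 1 1 = - X 0 0 ∧
      ∀ g ∈ G, ∃ c : ℝ, X * (g : Matrix (Fin 2) (Fin 2) ℝ) =
      c • ((g : Matrix (Fin 2) (Fin 2) ℝ) * X) := by
  obtain ⟨f, hf, hfV⟩ := Submodule.exists_le_ker_of_lt_top V (lt_top_iff_ne_top.2 hV)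
  have hgi : ∀ g : SL2R, g.1 * (g⁻¹).1 = 1 := fun g => by
    
    rw [← Matrix.SpecialLinearGroup.coe_mul, mul_inv_cancel, Matrix.SpecialLinearGroup.coe_one]
  have tr2 : ∀ A : Matrix (Fin 2) (Fin 2) ℝ, A.trace = 0 ↔ A 1 1 = - A 0 0 := by
    intro A; rw [Matrix.trace_fin_two]; constructor <;> intro h <;> linarith
  have back : ∀ (g : SL2R) (A : Matrix (Fin 2) (Fin 2) ℝ) (c : ℝ),
      (g⁻¹).1 * A * g.1 = c • A → A * g.1 = c • (g.1 * A) := by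
    intro g A c h
    rw [← Matrix.mul_smul, ← h, ← Matrix.mul_assoc, ← Matrix.mul_assoc, hgi, Matrix.one_mul]
  have trconj : ∀ (g : SL2R) (A B : Matrix (Fin 2) (Fin 2) ℝ),
      ((g⁻¹).1 * A * g.1 * B).trace = (A * (g.1 * B * (g⁻¹).1)).trace := by
    intro g A B
    rw [Matrix.mul_assoc, Matrix.mul_assoc, Matrix.trace_mul_comm]
    simp only [Matrix.mul_assoc]
  have trconj1 : ∀ (g : SL2R) (A : Matrix (Fin 2) (Fin 2) ℝ),
      ((g⁻¹).1 * A * g.1).trace = A.trace := by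
    intro g A
    have := trconj g A 1
    rw [Matrix.mul_one, Matrix.mul_one, hgi, Matrix.mul_one] at this
    exact this
  -- the functional as a trace
  let Y : Matrix (Fin 2) (Fin 2) ℝ := fun i j => f (Matrix.single j i 1)
  have hfY : ∀ A, f A = (Y * A).trace := by
    intro A
    conv_lhs => rw [Matrix.matrix_eq_sum_single A]
    have : ∀ (i j : Fin 2) (a : ℝ), f (Matrix.single i j a) = a * Y j i := by
      intro i j a
      have : Matrix.single i j a = a • Matrix.single i j (1 : ℝ) := by simp
      rw [this, map_smul]; rfl
    simp only [map_add, this, Fin.sum_univ_two, Matrix.trace_fin_two, Matrix.mul_apply]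
    ring
  have hY0 : Y ≠ 0 := by
    intro h
    apply hf
    ext1 A
    rw [hfY, h]; simp
  have hYV : ∀ A ∈ V, (Y * A).trace = 0 := fun A hA => by rw [← hfY]; exact hfV hA
  have hYtr : Y.trace = 0 := by simpa using hYV 1 hone
  -- traceless part of X
  let U : Matrix (Fin 2) (Fin 2) ℝ := X - (X.trace / 2) • (1 : Matrix (Fin 2) (Fin 2) ℝ)
  have hUV : U ∈ V := V.sub_mem hXV (V.smul_mem _ hone)
  have hU0 : U ≠ 0 := fun h => hX _ (sub_eq_zero.1 h)
  have hUtr : U.trace = 0 := by simp [U]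
  have coords : ∀ A : Matrix (Fin 2) (Fin 2) ℝ, A.trace = 0 → A ≠ 0 →
      ¬ (A 0 0 = 0 ∧ A 0 1 = 0 ∧ A 1 0 = 0) := by
    rintro A ht h ⟨e1, e2, e3⟩
    rw [tr2] at ht
    apply h
    ext i j
    fin_cases i <;> fin_cases j <;> simp [e1, e2, e3, ht]
  have ext2 : ∀ (A B : Matrix (Fin 2) (Fin 2) ℝ) (k : ℝ), A.trace = 0 → B.trace = 0 →
      B 0 0 = k * A 0 0 → B 0 1 = k * A 0 1 → B 1 0 = k * A 1 0 → B = k • A := by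
    intro A B k hA hB e1 e2 e3
    rw [tr2] at hA hB
    ext i j
    fin_cases i <;> fin_cases j <;> simp [e1, e2, e3, hA, hB]
  have dot : ∀ A B : Matrix (Fin 2) (Fin 2) ℝ, A.trace = 0 → B.trace = 0 → (A * B).trace = 0 →
      (2 * A 0 0) * B 0 0 + A 1 0 * B 0 1 + A 0 1 * B 1 0 = 0 := by
    intro A B hA hB h
    rw [tr2] at hA hB
    rw [Matrix.trace_fin_two, Matrix.mul_apply, Matrix.mul_apply, Fin.sum_univ_two,
      Fin.sum_univ_two, hA, hB] at h
    linarith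
  by_cases hcase : ∀ g ∈ G, ∃ c : ℝ, (g⁻¹).1 * U * g.1 = c • U
  · refine ⟨U, hU0, (tr2 _).1 hUtr, fun g hg => ?_⟩
    obtain ⟨c, hc⟩ := hcase g hg
    exact ⟨c, back g U c hc⟩
  · push Not at hcase
    obtain ⟨g₀, hg₀, hne⟩ := hcase
    refine ⟨Y, hY0, (tr2 _).1 hYtr, fun g hg => ?_⟩
    have hU'tr : ((g₀⁻¹).1 * U * g₀.1).trace = 0 := by rw [trconj1, hUtr]
    have hY'tr : ((g⁻¹).1 * Y * g.1).trace = 0 := by rw [trconj1, hYtr]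
    have hU'V := hinv g₀ hg₀ U hUV
    have hY'V : ∀ A ∈ V, ((g⁻¹).1 * Y * g.1 * A).trace = 0 := by
      intro A hA
      rw [trconj]
      apply hYV
      have := hinv g⁻¹ (G.inv_mem hg) A hA
      rwa [inv_inv] at this
    rcases aux_prop _ _ _ _ _ _ _ _ _ _ _ _ (coords U hUtr hU0)
      (by
        rintro ⟨e1, e2, e3⟩
        exact coords Y hYtr hY0 ⟨by linarith, e3, e2⟩)
      (dot _ _ hYtr hUtr (hYV U hUV)) (dot _ _ hYtr hU'tr (hYV _ hU'V))
      (dot _ _ hY'tr hUtr (hY'V U hUV)) (dot _ _ hY'tr hU'tr (hY'V _ hU'V)) with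
      ⟨k, e1, e2, e3⟩ | ⟨k, e1, e2, e3⟩
    · exact absurd (ext2 _ _ k hUtr hU'tr e1 e2 e3) (hne k)
    · exact ⟨k, back g Y k (ext2 _ _ k hYtr hY'tr (by linarith) e3 e2)⟩
open Filter Topology

theorem aux_deriv {𝔸 ι : Type*} [NormedRing 𝔸] [NormedAlgebra ℝ 𝔸] [CompleteSpace 𝔸] [Fintype ι]
    (v : ι → 𝔸) (l : List ι) :
    HasStrictFDerivAt (fun t : ι → ℝ => (l.map (fun i => NormedSpace.exp (t i • v i))).prod)
      ((l.map (fun i => (ContinuousLinearMap.proj (R := ℝ) (φ := fun _ : ι => ℝ) i).smulRight (v i))).sum)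
      0 := by
  induction l with
  | nil => simpa using hasStrictFDerivAt_const (𝕜 := ℝ) (1 : 𝔸) (0 : ι → ℝ)
  | cons i l ih =>
    have h1 : HasStrictFDerivAt (fun t : ι → ℝ => t i • v i)
        ((ContinuousLinearMap.proj (R := ℝ) (φ := fun _ : ι => ℝ) i).smulRight (v i)) 0 :=
      ((ContinuousLinearMap.proj (R := ℝ) (φ := fun _ : ι => ℝ) i).smulRight (v i)).hasStrictFDerivAt
    have h2 : HasStrictFDerivAt (NormedSpace.exp : 𝔸 → 𝔸) (1 : 𝔸 →L[ℝ] 𝔸) ((0 : ι → ℝ) i • v i) := by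
      simpa using hasStrictFDerivAt_exp_zero (𝕂 := ℝ) (𝔸 := 𝔸)
    have h3 := (h2.comp (0 : ι → ℝ) h1).mul' ih
    refine h3.congr_fderiv ?_
    ext x
    have : (List.map (fun _ : ι => (1 : 𝔸)) l).prod = 1 := by simp
    simp [this, add_comm]

theorem aux_open {𝔸 : Type*} [NormedRing 𝔸] [NormedAlgebra ℝ 𝔸] [FiniteDimensional ℝ 𝔸]
    (T : Submonoid 𝔸) (S : Set 𝔸) (hS : Submodule.span ℝ S = ⊤)
    (h : ∀ X ∈ S, ∀ t : ℝ, NormedSpace.exp (t • X) ∈ T) : (T : Set 𝔸) ∈ 𝓝 (1 : 𝔸) := by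
  have : CompleteSpace 𝔸 := FiniteDimensional.complete ℝ 𝔸
  obtain ⟨b, hbS, hb, hli⟩ := exists_linearIndependent ℝ S
  have : Fintype b := hli.setFinite.fintype
  have hd := aux_deriv (fun i : b => (i : 𝔸)) Finset.univ.toList
  have key := hd.map_nhds_eq_of_surj (by
    rw [eq_top_iff, ← hS, ← hb, Submodule.span_le]
    intro x hx
    classical
    refine ⟨Pi.single ⟨x, hx⟩ 1, ?_⟩
    rw [Finset.sum_map_toList]
    simp [Pi.single_apply])
  simp only [Pi.zero_apply, zero_smul, NormedSpace.exp_zero] at key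
  have e1 : (List.map (fun _ : b => (1 : 𝔸)) Finset.univ.toList).prod = 1 := by simp
  rw [e1] at key
  rw [← key, mem_map]
  refine Filter.univ_mem' fun t => ?_
  refine T.list_prod_mem ?_
  intro x hx
  obtain ⟨i, -, rfl⟩ := List.mem_map.1 hx
  exact h _ (hbS i.2) _

theorem aux_exists {𝔸 : Type*} [NormedRing 𝔸] [NormedAlgebra ℝ 𝔸] [FiniteDimensional ℝ 𝔸]
    (C : Set 𝔸) (hC : IsClosed C)
    (h : ∀ U ∈ 𝓝 (1 : 𝔸), ∃ g ∈ U, g ≠ 1 ∧ ∀ Y, NormedSpace.exp Y = g →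
      ∀ k : ℤ, NormedSpace.exp (k • Y) ∈ C) :
    ∃ X : 𝔸, X ≠ 0 ∧ ∀ t : ℝ, NormedSpace.exp (t • X) ∈ C := by
  have : CompleteSpace 𝔸 := FiniteDimensional.complete ℝ 𝔸
  have : ProperSpace 𝔸 := FiniteDimensional.proper ℝ 𝔸
  have hmap := (hasStrictFDerivAt_exp_zero (𝕂 := ℝ) (𝔸 := 𝔸)).map_nhds_eq_of_surj (by
    rw [eq_top_iff]; intro x _; exact ⟨x, rfl⟩)
  rw [NormedSpace.exp_zero] at hmap
  have hY : ∀ n : ℕ, ∃ Y : 𝔸, ‖Y‖ < 1 / ((n : ℝ) + 1) ∧ Y ≠ 0 ∧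
      ∀ k : ℤ, NormedSpace.exp (k • Y) ∈ C := by
    intro n
    have hb : NormedSpace.exp '' (Metric.ball (0 : 𝔸) (1 / ((n : ℝ) + 1))) ∈ 𝓝 (1 : 𝔸) := by
      rw [← hmap]
      exact image_mem_map (Metric.ball_mem_nhds _ (by positivity))
    obtain ⟨g, ⟨Y, hY, rfl⟩, hg1, hg⟩ := h _ hb
    refine ⟨Y, by simpa using hY, ?_, hg Y rfl⟩
    rintro rfl
    exact hg1 NormedSpace.exp_zero
  choose Y hY1 hY2 hY3 using hY
  have hsph : ∀ n, ‖Y n‖⁻¹ • Y n ∈ Metric.sphere (0 : 𝔸) 1 := by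
    intro n
    simp [norm_smul, hY2 n]
  obtain ⟨X, hX, φ, hφ, hlim⟩ := (isCompact_sphere (0 : 𝔸) 1).tendsto_subseq hsph
  refine ⟨X, ?_, fun t => ?_⟩
  · rintro rfl; simp at hX
  have hY0 : Tendsto (fun n => ‖Y n‖) atTop (𝓝 0) :=
    squeeze_zero (fun n => norm_nonneg _) (fun n => (hY1 n).le) tendsto_one_div_add_atTop_nhds_zero_nat
  have hY0' := hY0.comp hφ.tendsto_atTop
  have hfl : Tendsto (fun n => (⌊t / ‖Y (φ n)‖⌋ : ℝ) * ‖Y (φ n)‖) atTop (𝓝 t) := by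
    rw [tendsto_iff_norm_sub_tendsto_zero]
    refine squeeze_zero (fun n => norm_nonneg _) (fun n => ?_) hY0'
    have hp : 0 < ‖Y (φ n)‖ := norm_pos_iff.2 (hY2 _)
    have f1 := Int.floor_le (t / ‖Y (φ n)‖)
    have f2 := Int.lt_floor_add_one (t / ‖Y (φ n)‖)
    have e : t = t / ‖Y (φ n)‖ * ‖Y (φ n)‖ := by field_simp
    rw [Real.norm_eq_abs, abs_le]
    simp only [Function.comp]
    constructor <;> nlinarith
  have hl2 := hfl.smul hlim
  let +nondep : NormedAlgebra ℚ 𝔸 := .restrictScalars ℚ ℝ 𝔸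
  have hl3 := ((NormedSpace.exp_continuous (𝔸 := 𝔸)).tendsto (t • X)).comp hl2
  refine hC.mem_of_tendsto hl3 (Eventually.of_forall fun n => ?_)
  have hp : ‖Y (φ n)‖ ≠ 0 := norm_ne_zero_iff.2 (hY2 _)
  have := hY3 (φ n) ⌊t / ‖Y (φ n)‖⌋
  simp only [Function.comp]
  rw [smul_smul, mul_assoc, mul_inv_cancel₀ hp, mul_one, Int.cast_smul_eq_zsmul]
  exact this

open Filter Topology

instance aux_topgroup : IsTopologicalGroup SL2R :=
  (inferInstance : @IsTopologicalGroup (Matrix.SpecialLinearGroup (Fin 2) ℝ)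
    Matrix.SpecialLinearGroup.instTopologicalSpace _)

section MatrixNorm

attribute [local instance] Matrix.linftyOpNormedRing Matrix.linftyOpNormedAlgebra

theorem aux_open_matrix (T : Submonoid (Matrix (Fin 2) (Fin 2) ℝ))
    (S : Set (Matrix (Fin 2) (Fin 2) ℝ)) (hS : Submodule.span ℝ S = ⊤)
    (h : ∀ X ∈ S, ∀ t : ℝ, NormedSpace.exp (t • X) ∈ T) :
    (T : Set (Matrix (Fin 2) (Fin 2) ℝ)) ∈ @nhds _ instTopologicalSpaceMatrix 1 :=
  aux_open T S hS h

theorem aux_exists_matrix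
    (C : Set (Matrix (Fin 2) (Fin 2) ℝ)) (hC : @IsClosed _ instTopologicalSpaceMatrix C)
    (h : ∀ U ∈ @nhds _ instTopologicalSpaceMatrix (1 : Matrix (Fin 2) (Fin 2) ℝ),
      ∃ g ∈ U, g ≠ 1 ∧ ∀ Y, NormedSpace.exp Y = g →
      ∀ k : ℤ, NormedSpace.exp (k • Y) ∈ C) :
    ∃ X : Matrix (Fin 2) (Fin 2) ℝ, X ≠ 0 ∧ ∀ t : ℝ, NormedSpace.exp (t • X) ∈ C :=
  aux_exists C hC h

end MatrixNorm

theorem aux_exp_scalar (t : ℝ) :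
    NormedSpace.exp (t • (1 : Matrix (Fin 2) (Fin 2) ℝ)) = Real.exp t • 1 := by
  have : t • (1 : Matrix (Fin 2) (Fin 2) ℝ) = Matrix.diagonal (fun _ => t) := by
    rw [← Matrix.smul_one_eq_diagonal]
  rw [this, Matrix.exp_diagonal, Matrix.smul_one_eq_diagonal]
  congr 1
  ext i
  rw [Pi.coe_exp, Real.exp_eq_exp_ℝ]

theorem aux_exp_zsmul (g : SL2R) (Y : Matrix (Fin 2) (Fin 2) ℝ)
    (h : NormedSpace.exp Y = (g : Matrix (Fin 2) (Fin 2) ℝ)) (k : ℤ) :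
    NormedSpace.exp (k • Y) = ((g ^ k : SL2R) : Matrix (Fin 2) (Fin 2) ℝ) := by
  have hg : IsUnit (g : Matrix (Fin 2) (Fin 2) ℝ).det := by simp
  rw [Matrix.exp_zsmul, h]
  obtain ⟨n, rfl | rfl⟩ := k.eq_nat_or_neg
  · simp
  · rw [Matrix.zpow_neg hg, _root_.zpow_neg, zpow_natCast, zpow_natCast]
    apply Matrix.inv_eq_right_inv
    rw [← Matrix.SpecialLinearGroup.coe_pow, ← Matrix.SpecialLinearGroup.coe_mul, mul_inv_cancel,
      Matrix.SpecialLinearGroup.coe_one]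

/-- If a submonoid of the matrices contains all determinant one matrices near the identity, it
contains all determinant one matrices. -/
theorem aux_generate (M : Submonoid (Matrix (Fin 2) (Fin 2) ℝ))
    (U : Set (Matrix (Fin 2) (Fin 2) ℝ)) (hU : U ∈ 𝓝 (1 : Matrix (Fin 2) (Fin 2) ℝ))
    (h : ∀ A ∈ U, A.det = 1 → A ∈ M) (A : Matrix (Fin 2) (Fin 2) ℝ) (hA : A.det = 1) : A ∈ M := by
  have hup : ∀ x : ℝ, !![1, x; 0, 1] ∈ M := by
    intro x
    have hc : Tendsto (fun n : ℕ => !![1, x / ((n : ℝ) + 1); 0, 1]) atTop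
        (𝓝 (1 : Matrix (Fin 2) (Fin 2) ℝ)) := by
      have h0 : Tendsto (fun n : ℕ => x / ((n : ℝ) + 1)) atTop (𝓝 0) := by
        simpa [div_eq_mul_inv] using (tendsto_one_div_add_atTop_nhds_zero_nat (𝕜 := ℝ)).const_mul x
      have hcont : Continuous (fun y : ℝ => !![1, y; 0, 1]) := by fun_prop
      have := (hcont.tendsto 0).comp h0
      rwa [← Matrix.one_fin_two] at this
    obtain ⟨n, hn⟩ := (hc.eventually hU).exists
    have h1 := M.pow_mem (h _ hn (by simp [Matrix.det_fin_two])) (n + 1)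
    have hp : ∀ (y : ℝ) (m : ℕ), !![1, y; 0, 1] ^ m = !![1, m * y; 0, 1] := by
      intro y m
      induction m with
      | zero => simp [Matrix.one_fin_two]
      | succ m ih => rw [pow_succ, ih]; simp [Matrix.mul_fin_two]; ring
    rw [hp] at h1
    have : ((n + 1 : ℕ) : ℝ) * (x / ((n : ℝ) + 1)) = x := by push_cast; field_simp
    rwa [this] at h1
  have hlo : ∀ x : ℝ, !![1, 0; x, 1] ∈ M := by
    intro x
    have hc : Tendsto (fun n : ℕ => !![1, 0; x / ((n : ℝ) + 1), 1]) atTop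
        (𝓝 (1 : Matrix (Fin 2) (Fin 2) ℝ)) := by
      have h0 : Tendsto (fun n : ℕ => x / ((n : ℝ) + 1)) atTop (𝓝 0) := by
        simpa [div_eq_mul_inv] using (tendsto_one_div_add_atTop_nhds_zero_nat (𝕜 := ℝ)).const_mul x
      have hcont : Continuous (fun y : ℝ => !![1, 0; y, 1]) := by fun_prop
      have := (hcont.tendsto 0).comp h0
      rwa [← Matrix.one_fin_two] at this
    obtain ⟨n, hn⟩ := (hc.eventually hU).exists
    have h1 := M.pow_mem (h _ hn (by simp [Matrix.det_fin_two])) (n + 1)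
    have hp : ∀ (y : ℝ) (m : ℕ), !![1, 0; y, 1] ^ m = !![1, 0; m * y, 1] := by
      intro y m
      induction m with
      | zero => simp [Matrix.one_fin_two]
      | succ m ih => rw [pow_succ, ih]; simp [Matrix.mul_fin_two]; ring
    rw [hp] at h1
    have : ((n + 1 : ℕ) : ℝ) * (x / ((n : ℝ) + 1)) = x := by push_cast; field_simp
    rwa [this] at h1
  have hne : ∀ a b c d : ℝ, a * d - b * c = 1 → c ≠ 0 → !![a, b; c, d] ∈ M := by
    intro a b c d hdet hc
    have e : !![a, b; c, d] = !![1, (a - 1) / c; 0, 1] * !![1, 0; c, 1] * !![1, (d - 1) / c; 0, 1] := by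
      have hb : b = (a * d - 1) / c := by field_simp; linarith
      simp only [Matrix.mul_fin_two]
      ext i j
      fin_cases i <;> fin_cases j <;> simp [hb] <;> field_simp <;> ring
    rw [e]
    exact M.mul_mem (M.mul_mem (hup _) (hlo _)) (hup _)
  rw [Matrix.det_fin_two] at hA
  rw [Matrix.eta_fin_two A]
  by_cases hc : A 1 0 = 0
  · have ha : A 0 0 ≠ 0 := by
      intro h; rw [h, hc] at hA; simp at hA
    have e : !![A 0 0, A 0 1; A 1 0, A 1 1] = !![1, 0; -1, 1] *
        !![A 0 0, A 0 1; A 0 0 + A 1 0, A 0 1 + A 1 1] := by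
      simp [Matrix.mul_fin_two]
    rw [e]
    refine M.mul_mem (hlo _) (hne _ _ _ _ (by linarith) (by rwa [hc, add_zero]))
  · exact hne _ _ _ _ hA hc

theorem aux_dense (G : Subgroup SL2R)
    (h1 : ¬ ∃ z : UpperHalfPlane, ∀ g ∈ G, g • z = z)
    (h2 : ¬ ∃ W : Submodule ℝ (Fin 2 → ℝ), Module.finrank ℝ W = 1 ∧
      ∀ g ∈ G, W.map (Matrix.toLin' (g : Matrix (Fin 2) (Fin 2) ℝ)) = W)
    (h3 : ¬ ∃ W₁ W₂ : Submodule ℝ (Fin 2 → ℝ),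
      Module.finrank ℝ W₁ = 1 ∧ Module.finrank ℝ W₂ = 1 ∧ W₁ ≠ W₂ ∧
      ∀ g ∈ G,
        (W₁.map (Matrix.toLin' (g : Matrix (Fin 2) (Fin 2) ℝ)) = W₁ ∧
          W₂.map (Matrix.toLin' (g : Matrix (Fin 2) (Fin 2) ℝ)) = W₂) ∨
        (W₁.map (Matrix.toLin' (g : Matrix (Fin 2) (Fin 2) ℝ)) = W₂ ∧
          W₂.map (Matrix.toLin' (g : Matrix (Fin 2) (Fin 2) ℝ)) = W₁))
    (hnd : ∀ U ∈ 𝓝 (1 : Matrix (Fin 2) (Fin 2) ℝ), ∃ g ∈ G,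
      (g : Matrix (Fin 2) (Fin 2) ℝ) ∈ U ∧ g ≠ 1)
    (A : Matrix (Fin 2) (Fin 2) ℝ) (hA : A.det = 1) :
    A ∈ closure ((fun g : SL2R => (g : Matrix (Fin 2) (Fin 2) ℝ)) '' (G : Set SL2R)) := by
  let M0 : Submonoid (Matrix (Fin 2) (Fin 2) ℝ) :=
    { carrier := (fun g : SL2R => (g : Matrix (Fin 2) (Fin 2) ℝ)) '' (G : Set SL2R)
      one_mem' := ⟨1, G.one_mem, Matrix.SpecialLinearGroup.coe_one⟩
      mul_mem' := by
        rintro _ _ ⟨a, ha, rfl⟩ ⟨b, hb, rfl⟩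
        exact ⟨a * b, G.mul_mem ha hb, Matrix.SpecialLinearGroup.coe_mul a b⟩ }
  let M := M0.topologicalClosure
  change A ∈ M
  have hM0 : ∀ g ∈ G, (g : Matrix (Fin 2) (Fin 2) ℝ) ∈ M := fun g hg =>
    M0.le_topologicalClosure ⟨g, hg, rfl⟩
  have hMcl : IsClosed (M : Set (Matrix (Fin 2) (Fin 2) ℝ)) := M0.isClosed_topologicalClosure
  have hMdet : ∀ B ∈ M, B.det = 1 := by
    have : (M : Set (Matrix (Fin 2) (Fin 2) ℝ)) ⊆ {B | B.det = 1} := by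
      refine closure_minimal ?_ (isClosed_eq (by fun_prop) continuous_const)
      rintro _ ⟨g, -, rfl⟩
      exact g.det_coe
    exact this
  obtain ⟨X, hX0, hX⟩ := aux_exists_matrix (M : Set (Matrix (Fin 2) (Fin 2) ℝ)) hMcl (by
    intro U hU
    obtain ⟨g, hg, hgU, hg1⟩ := hnd U hU
    refine ⟨g, hgU, ?_, fun Y hY k => ?_⟩
    · intro h
      exact hg1 (Subtype.ext h)
    · rw [aux_exp_zsmul g Y hY k]
      exact hM0 _ (G.zpow_mem hg k))
  let T : Submonoid (Matrix (Fin 2) (Fin 2) ℝ) :=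
    { carrier := {B | ∃ s : ℝ, 0 < s ∧ s • B ∈ M}
      one_mem' := ⟨1, one_pos, by simp⟩
      mul_mem' := by
        rintro a b ⟨s, hs, ha⟩ ⟨t, ht, hb⟩
        refine ⟨s * t, by positivity, ?_⟩
        have := M.mul_mem ha hb
        rwa [smul_mul_smul_comm] at this }
  let S : Set (Matrix (Fin 2) (Fin 2) ℝ) := {X | ∀ t : ℝ, NormedSpace.exp (t • X) ∈ T}
  have hXS : X ∈ S := fun t => ⟨1, one_pos, by rw [one_smul]; exact hX t⟩
  have h1S : (1 : Matrix (Fin 2) (Fin 2) ℝ) ∈ S := by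
    intro t
    refine ⟨Real.exp (-t), Real.exp_pos _, ?_⟩
    rw [aux_exp_scalar, smul_smul, ← Real.exp_add]
    simp
  have hXns : ∀ c : ℝ, X ≠ c • (1 : Matrix (Fin 2) (Fin 2) ℝ) := by
    rintro c rfl
    have := hMdet _ (hX 1)
    rw [one_smul, aux_exp_scalar, Matrix.det_smul, Matrix.det_one, mul_one, Fintype.card_fin,
      ← Real.exp_nat_mul, Real.exp_eq_one_iff] at this
    apply hX0
    have : c = 0 := by simpa using this
    rw [this, zero_smul]
  have hSinv : ∀ g ∈ G, ∀ B ∈ S, (g⁻¹).1 * B * g.1 ∈ S := by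
    intro g hg B hB t
    obtain ⟨s, hs, hsB⟩ := hB t
    refine ⟨s, hs, ?_⟩
    have hu : IsUnit (g : Matrix (Fin 2) (Fin 2) ℝ) := by
      rw [Matrix.isUnit_iff_isUnit_det]; simp
    have hinv : (g⁻¹).1 = (g.1)⁻¹ := by
      symm
      apply Matrix.inv_eq_right_inv
      rw [← Matrix.SpecialLinearGroup.coe_mul, mul_inv_cancel, Matrix.SpecialLinearGroup.coe_one]
    have e : NormedSpace.exp (t • ((g⁻¹).1 * B * g.1)) = (g⁻¹).1 * NormedSpace.exp (t • B) * g.1 := by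
      rw [hinv, ← Matrix.exp_conj' _ _ hu]
      simp
    rw [e]
    have := M.mul_mem (M.mul_mem (hM0 _ (G.inv_mem hg)) hsB) (hM0 _ hg)
    rwa [Matrix.mul_smul, Matrix.smul_mul] at this
  have hspan : Submodule.span ℝ S = ⊤ := by
    by_contra hne
    obtain ⟨Z, hZ0, hZtr, hZ⟩ := aux_span G _ hne (Submodule.subset_span h1S) X
      (Submodule.subset_span hXS) hXns (by
        intro g hg B hB
        induction hB using Submodule.span_induction with
        | mem B hB => exact Submodule.subset_span (hSinv g hg B hB)
        | zero => simp
        | add a b _ _ ha hb =>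
          rw [Matrix.mul_add, Matrix.add_mul]
          exact Submodule.add_mem _ ha hb
        | smul c a _ ha =>
          rw [Matrix.mul_smul, Matrix.smul_mul]
          exact Submodule.smul_mem _ _ ha)
    exact aux_invariant G h1 h2 h3 Z hZ0 hZtr hZ
  have hT := aux_open_matrix T S hspan (fun Y hY t => hY t)
  refine aux_generate M _ hT ?_ A hA
  rintro B ⟨s, hs, hsB⟩ hB
  have := hMdet _ hsB
  rw [Matrix.det_smul, hB, mul_one, Fintype.card_fin] at this
  have hs1 : s = 1 := by nlinarith
  rwa [hs1, one_smul] at hsB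

/-- A subgroup of `PSL(2,ℝ)` that fixes no point of `ℍ`, preserves no line of `ℝ²`, and
preserves no unordered pair of distinct lines of `ℝ²` is either discrete or dense. -/
theorem discrete_or_dense (H : Subgroup PSL2R)
    (h1 : ¬ ∃ z : UpperHalfPlane,
      ∀ g ∈ H.comap (QuotientGroup.mk' (Subgroup.center SL2R)), g • z = z)
    (h2 : ¬ ∃ W : Submodule ℝ (Fin 2 → ℝ), Module.finrank ℝ W = 1 ∧
      ∀ g ∈ H.comap (QuotientGroup.mk' (Subgroup.center SL2R)),
        W.map (Matrix.toLin' (g : Matrix (Fin 2) (Fin 2) ℝ)) = W)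
    (h3 : ¬ ∃ W₁ W₂ : Submodule ℝ (Fin 2 → ℝ),
      Module.finrank ℝ W₁ = 1 ∧ Module.finrank ℝ W₂ = 1 ∧ W₁ ≠ W₂ ∧
      ∀ g ∈ H.comap (QuotientGroup.mk' (Subgroup.center SL2R)),
        (W₁.map (Matrix.toLin' (g : Matrix (Fin 2) (Fin 2) ℝ)) = W₁ ∧
          W₂.map (Matrix.toLin' (g : Matrix (Fin 2) (Fin 2) ℝ)) = W₂) ∨
        (W₁.map (Matrix.toLin' (g : Matrix (Fin 2) (Fin 2) ℝ)) = W₂ ∧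
          W₂.map (Matrix.toLin' (g : Matrix (Fin 2) (Fin 2) ℝ)) = W₁)) :
    DiscreteTopology H ∨ Dense (H : Set PSL2R) := by
  rw [or_iff_not_imp_left]
  intro hnd
  set G := H.comap (QuotientGroup.mk' (Subgroup.center SL2R)) with hG
  have key := aux_dense G h1 h2 h3 (by
    intro U hU
    by_contra hcon
    push Not at hcon
    apply hnd
    apply discreteTopology_of_isOpen_singleton_one
    have hU' : (fun g : SL2R => (g : Matrix (Fin 2) (Fin 2) ℝ)) ⁻¹' U ∈ 𝓝 (1 : SL2R) := by
      rw [nhds_induced]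
      exact preimage_mem_comap (by simpa using hU)
    have hV := (QuotientGroup.isOpenMap_coe (N := Subgroup.center SL2R)).image_mem_nhds hU'
    have hsing : ({1} : Set H) ∈ 𝓝 (1 : H) := by
      rw [nhds_induced]
      refine ⟨_, hV, ?_⟩
      rintro ⟨x, hx⟩ ⟨g, hgU, hgx⟩
      have hgG : g ∈ G := by
        change (g : PSL2R) ∈ H
        rw [hgx]; exact hx
      have hg1 := hcon g hgG hgU
      apply Subtype.ext
      change x = 1
      rw [hg1] at hgx
      exact hgx.symm
    rw [isOpen_iff_mem_nhds]
    intro x hx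
    rw [Set.mem_singleton_iff] at hx
    rw [hx]
    exact hsing)
  have hdG : Dense (G : Set SL2R) := by
    intro g
    rw [closure_induced]
    exact key g g.det_coe
  have hsurj : Function.Surjective (QuotientGroup.mk' (Subgroup.center SL2R)) :=
    QuotientGroup.mk'_surjective _
  have := hsurj.denseRange.dense_image QuotientGroup.continuous_mk hdG
  refine this.mono ?_
  rintro _ ⟨g, hg, rfl⟩
  exact hg
end

section
/- Let H be a finitely generated subgroup of PSL(2,ℝ) whose underlying set is dense in PSL(2,ℝ). Then H contains an elliptic element of infinite order: there exist h ∈ H such that h^n ≠ 1 for every n ≥ 1, together with a representative ĥ ∈ SL(2,ℝ) of h (i.e. the image of ĥ in PSL(2,ℝ) is h) satisfying |trace(ĥ)| < 2. -/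
/-- The trace of a finite order complex 2×2 matrix is an algebraic integer of modulus at most 2. -/
theorem trace_of_pow_eq_one (A : Matrix (Fin 2) (Fin 2) ℂ) (m : ℕ) (hm : 1 ≤ m)
    (hA : A ^ m = 1) : IsIntegral ℤ A.trace ∧ ‖A.trace‖ ≤ 2 := by
  have hroot : ∀ μ ∈ A.charpoly.roots, μ ^ m = 1 := by
    intro μ hμ
    have h1 : μ ∈ spectrum ℂ A :=
      Matrix.mem_spectrum_of_isRoot_charpoly (Polynomial.isRoot_of_mem_roots hμ)
    have h2 := spectrum.pow_mem_pow A m h1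
    rw [hA] at h2
    simpa using h2
  have hcard : A.charpoly.roots.card = 2 := by
    rw [← (IsAlgClosed.splits A.charpoly).natDegree_eq_card_roots, Matrix.charpoly_natDegree_eq_dim]
    simp
  rw [Matrix.trace_eq_sum_roots_charpoly A]
  obtain ⟨x, y, hxy⟩ := Multiset.card_eq_two.mp hcard
  rw [hxy] at hroot ⊢
  have hx : x ^ m = 1 := hroot x (by simp)
  have hy : y ^ m = 1 := hroot y (by simp)
  have hint : ∀ z : ℂ, z ^ m = 1 → IsIntegral ℤ z := fun z hz =>
    IsIntegral.of_pow hm (by rw [hz]; exact isIntegral_one)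
  have hs : ({x, y} : Multiset ℂ).sum = x + y := by simp
  rw [hs]
  refine ⟨(hint x hx).add (hint y hy), ?_⟩
  have hx1 : ‖x‖ = 1 := Complex.norm_eq_one_of_pow_eq_one hx (by omega)
  have hy1 : ‖y‖ = 1 := Complex.norm_eq_one_of_pow_eq_one hy (by omega)
  calc ‖x + y‖ ≤ ‖x‖ + ‖y‖ := norm_add_le _ _
    _ = 2 := by rw [hx1, hy1]; norm_num

/-- Traces of finite order 2×2 matrices over a finitely generated `ℚ`-subalgebra of `ℝ`
form a finite set. -/
theorem finite_torsion_traces (A : Subalgebra ℚ ℝ) [Algebra.FiniteType ℚ A] :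
    {t : A | ∃ M : Matrix (Fin 2) (Fin 2) A, ∃ m : ℕ, 1 ≤ m ∧ M ^ m = 1 ∧ M.trace = t}.Finite := by
  obtain ⟨I, hI⟩ := Ideal.exists_maximal A
  let : Field (A ⧸ I) := Ideal.Quotient.field I
  have hfin : Module.Finite ℚ (A ⧸ I) := finite_of_finite_type_of_isJacobsonRing ℚ (A ⧸ I)
  have : CharZero (A ⧸ I) := algebraRat.charZero _
  have : NumberField (A ⧸ I) :=
    { to_charZero := inferInstance
      to_finiteDimensional := by convert hfin; exact Subsingleton.elim _ _ }
  have hpow : ∀ {R : Type} [CommRing R] (f : A →+* R) (M : Matrix (Fin 2) (Fin 2) A) (m : ℕ),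
      M ^ m = 1 → (f.mapMatrix M) ^ m = 1 := by
    intro R _ f M m h
    rw [← map_pow, h, map_one]
  have htr : ∀ {R : Type} [CommRing R] (f : A →+* R) (M : Matrix (Fin 2) (Fin 2) A),
      (f.mapMatrix M).trace = f M.trace := by
    intro R _ f M
    simp [Matrix.trace_fin_two]
  let e : A →+* ℂ := Complex.ofRealHom.comp A.val.toRingHom
  have he : Function.Injective e := by
    intro x y h
    exact Subtype.ext (Complex.ofReal_injective h)
  have hint : ∀ t : A, (∃ M : Matrix (Fin 2) (Fin 2) A, ∃ m : ℕ, 1 ≤ m ∧ M ^ m = 1 ∧ M.trace = t) →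
      IsIntegral ℤ t := by
    rintro t ⟨M, m, hm, hM, rfl⟩
    have h1 := (trace_of_pow_eq_one _ m hm (hpow e M m hM)).1
    rw [htr] at h1
    exact (isIntegral_algHom_iff (e.toIntAlgHom) he).mp h1
  let q : A →+* A ⧸ I := Ideal.Quotient.mk I
  have hF := NumberField.Embeddings.finite_of_norm_le (A ⧸ I) ℂ 2
  refine Set.Finite.of_finite_image (f := q) (hF.subset ?_) ?_
  · rintro _ ⟨t, ht, rfl⟩
    refine ⟨(hint t ht).map q.toIntAlgHom, ?_⟩
    intro φ
    obtain ⟨M, m, hm, hM, rfl⟩ := ht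
    have h1 := (trace_of_pow_eq_one _ m hm (hpow (φ.comp q) M m hM)).2
    rw [htr] at h1
    exact h1
  · intro s hs t ht hst
    by_contra hne
    have h1 : IsIntegral ℚ (s - t) := ((hint s hs).sub (hint t ht)).tower_top
    have h2 : IsUnit (s - t) := h1.isUnit (sub_ne_zero.mpr hne)
    have h3 : IsUnit (q (s - t)) := h2.map q
    rw [map_sub, hst, sub_self] at h3
    exact not_isUnit_zero h3

theorem center_eq_one_or (z : SL2R) (hz : z ∈ Subgroup.center SL2R) : z = 1 ∨ z = -1 := by
  obtain ⟨r, hr, hz⟩ := Matrix.SpecialLinearGroup.mem_center_iff.mp hz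
  have hr' : r ^ 2 = 1 := by simpa using hr
  rcases mul_self_eq_one_iff.mp ((sq r).symm.trans hr') with rfl | rfl
  · left
    ext i j
    rw [← hz]
    simp
  · right
    ext i j
    rw [← hz]
    fin_cases i <;> fin_cases j <;> simp

/-- A dense finitely generated subgroup: lifts have entries in a f.g. algebra. -/
theorem lifts_in_fg_algebra (H : Subgroup PSL2R) (hfg : H.FG) :
    ∃ A : Subalgebra ℚ ℝ, Algebra.FiniteType ℚ A ∧
      ∀ g : SL2R, QuotientGroup.mk' (Subgroup.center SL2R) g ∈ H →
        ∃ M : Matrix.SpecialLinearGroup (Fin 2) A,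
          Matrix.SpecialLinearGroup.map A.val.toRingHom M = g := by
  classical
  obtain ⟨S, hS⟩ := hfg
  let lift : PSL2R → SL2R := Quotient.out
  have hlift : ∀ s, QuotientGroup.mk' (Subgroup.center SL2R) (lift s) = s := fun s =>
    Quotient.out_eq s
  let E : Finset ℝ := S.biUnion fun s =>
    (Finset.univ : Finset (Fin 2 × Fin 2)).image fun p => (lift s).1 p.1 p.2
  let A : Subalgebra ℚ ℝ := Algebra.adjoin ℚ (E : Set ℝ)
  refine ⟨A, ?_, ?_⟩
  · exact (Subalgebra.fg_iff_finiteType _).mp ⟨E, rfl⟩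
  let f := Matrix.SpecialLinearGroup.map (n := Fin 2) A.val.toRingHom
  have hH : H ≤ f.range.map (QuotientGroup.mk' (Subgroup.center SL2R)) := by
    rw [← hS, Subgroup.closure_le]
    intro s hs
    have hmem : ∀ i j, (lift s).1 i j ∈ A := by
      intro i j
      apply Algebra.subset_adjoin
      simp only [E, Finset.coe_biUnion, Set.mem_iUnion]
      exact ⟨s, hs, Finset.mem_coe.mpr (Finset.mem_image.mpr ⟨(i, j), Finset.mem_univ _, rfl⟩)⟩
    refine ⟨lift s, ⟨⟨fun i j => ⟨(lift s).1 i j, hmem i j⟩, ?_⟩, ?_⟩, hlift s⟩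
    · apply Subtype.ext
      have h1 := (lift s).2
      rw [Matrix.det_fin_two] at h1
      exact (congrArg Subtype.val (Matrix.det_fin_two _)).trans h1
    · ext i j
      rfl
  intro g hg
  obtain ⟨_, ⟨M, rfl⟩, hM⟩ := hH hg
  have hz : (f M)⁻¹ * g ∈ Subgroup.center SL2R := QuotientGroup.eq.mp hM
  rcases center_eq_one_or _ hz with h | h
  · exact ⟨M, inv_mul_eq_one.mp h⟩
  · refine ⟨-M, ?_⟩
    have : g = f M * (-1) := by rw [← h]; group
    rw [this]
    ext i j
    simp [f]

theorem isOpenMap_mk_PSL : IsOpenMap (QuotientGroup.mk' (Subgroup.center SL2R)) := by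
  have : ContinuousMul SL2R :=
    { continuous_mul := by
        refine continuous_induced_rng.mpr ?_
        have h : Continuous fun g : SL2R => (g : Matrix (Fin 2) (Fin 2) ℝ) := continuous_induced_dom
        exact (h.comp continuous_fst).matrix_mul (h.comp continuous_snd) }
  exact QuotientGroup.isOpenMap_coe

/-- A finitely generated subgroup of `PSL(2,ℝ)` that is dense contains an elliptic
element of infinite order. -/
theorem dense_fg_subgroup_has_infinite_order_elliptic (H : Subgroup PSL2R)
    (hfg : H.FG) (hd : Dense (H : Set PSL2R)) :
    ∃ h ∈ H, (∀ n : ℕ, 1 ≤ n → h ^ n ≠ 1) ∧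
      ∃ hrep : SL2R, QuotientGroup.mk' (Subgroup.center SL2R) hrep = h ∧
        |Matrix.trace (hrep : Matrix (Fin 2) (Fin 2) ℝ)| < 2 := by
  obtain ⟨A, hA, hlift⟩ := lifts_in_fg_algebra H hfg
  have hfin := (finite_torsion_traces A).image (fun t : A => (t : ℝ))
  set F := (fun t : A => (t : ℝ)) '' {t : A | ∃ M : Matrix (Fin 2) (Fin 2) A, ∃ m : ℕ,
    1 ≤ m ∧ M ^ m = 1 ∧ M.trace = t} with hF
  have hcont : Continuous fun g : SL2R => Matrix.trace (g : Matrix (Fin 2) (Fin 2) ℝ) :=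
    Continuous.matrix_trace continuous_induced_dom
  let W : Set ℝ := Set.Ioo (-2) 2 \ F
  have hW : IsOpen W := isOpen_Ioo.sdiff hfin.isClosed
  have hopen : IsOpen ((fun g : SL2R => Matrix.trace (g : Matrix (Fin 2) (Fin 2) ℝ)) ⁻¹' W) :=
    hW.preimage hcont
  obtain ⟨t, ht⟩ : W.Nonempty :=
    ((Set.Ioo_infinite (by norm_num : (-2 : ℝ) < 2)).sdiff hfin).nonempty
  let g₀ : SL2R := ⟨!![t, -1; 1, 0], by simp [Matrix.det_fin_two]⟩
  have hg₀ : g₀ ∈ (fun g : SL2R => Matrix.trace (g : Matrix (Fin 2) (Fin 2) ℝ)) ⁻¹' W := by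
    have h1 : Matrix.trace (g₀ : Matrix (Fin 2) (Fin 2) ℝ) = t := by
      simp [g₀, Matrix.trace_fin_two]
    rw [Set.mem_preimage, h1]
    exact ht
  obtain ⟨h, ⟨g, hgW, rfl⟩, hh⟩ := hd.inter_open_nonempty _ (isOpenMap_mk_PSL _ hopen)
    ⟨_, Set.mem_image_of_mem _ hg₀⟩
  refine ⟨_, hh, ?_, g, rfl, abs_lt.mpr hgW.1⟩
  intro n hn hpow
  have hc : g ^ n ∈ Subgroup.center SL2R := by
    rw [← map_pow] at hpow
    exact (QuotientGroup.eq_one_iff _).mp hpow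
  have hg1 : g ^ (n * 2) = 1 := by
    rw [pow_mul]
    rcases center_eq_one_or _ hc with h | h <;> rw [h] <;> simp
  obtain ⟨M, rfl⟩ := hlift g hh
  apply hgW.2
  have hM : M ^ (n * 2) = 1 := by
    rw [← map_pow] at hg1
    ext i j
    have := congrArg (fun x : SL2R => x.1 i j) hg1
    have h2 : (((M ^ (n * 2)).1 i j : A) : ℝ) = (((1 : Matrix (Fin 2) (Fin 2) A) i j : A) : ℝ) := by
      refine Eq.trans this ?_
      simp only [Matrix.SpecialLinearGroup.coe_one, Matrix.one_apply]
      split_ifs <;> simp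
    exact congrArg Subtype.val (Subtype.ext h2)
  refine ⟨M.1.trace, ⟨M.1, n * 2, by omega, ?_, rfl⟩, ?_⟩
  · have := congrArg Subtype.val hM
    simpa using this
  · simp [Matrix.trace_fin_two]
end
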